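/- arXiv:1910.12280 — 4 statements merged into one kernel-verified Lean document; each statement's English description precedes it below -/
import Mathlib

section
/- Let R be a commutative ring, s_1,…,s_k a permutable weak regular sequence of non-units in R, A an index set, and F = ∏_{i∈A} R the product R-module. Let U ⊆ F be the R-submodule generated by a_1,…,a_n, where each a_l = c_l·m_l·e_{j_l} with c_l a unit of R, m_l an s-monomial, j_l ∈ A, and e_j ∈ F the element with 1 in coordinate j and 0 elsewhere. Then there exist p ≤ k, finitely generated free R-modules F_0,…,F_p, and an exact sequence 0 → F_p → F_{p−1} → ⋯ → F_1 → F_0 → U → 0 of R-modules. -/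
open MvPolynomial
open scoped MonomialOrder

namespace PaperGB

variable {n : ℕ} {R : Type*} [CommSemiring R]

/-- The degree (leading exponent) of a multivariate polynomial w.r.t. a monomial order. -/
noncomputable def mDeg (m : MonomialOrder (Fin n)) (f : MvPolynomial (Fin n) R) :
    Fin n →₀ ℕ :=
  m.toSyn.symm (f.support.sup fun d => m.toSyn d)

/-- The leading coefficient. -/
noncomputable def mLC (m : MonomialOrder (Fin n)) (f : MvPolynomial (Fin n) R) : R :=
  f.coeff (mDeg m f)

/-- The leading term. -/
noncomputable def mLT (m : MonomialOrder (Fin n)) (f : MvPolynomial (Fin n) R) :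
    MvPolynomial (Fin n) R :=
  monomial (mDeg m f) (mLC m f)

variable {R : Type*} [CommRing R]

/-- The leading term ideal. -/
noncomputable def mLTIdeal (m : MonomialOrder (Fin n)) (I : Ideal (MvPolynomial (Fin n) R)) :
    Ideal (MvPolynomial (Fin n) R) :=
  Ideal.span ((fun g => mLT m g) '' {g | g ∈ I ∧ g ≠ 0})

/-- `f` is a Gröbner basis of `I`. -/
def IsGroebnerBasis (m : MonomialOrder (Fin n)) (I : Ideal (MvPolynomial (Fin n) R))
    {k : ℕ} (f : Fin k → MvPolynomial (Fin n) R) : Prop :=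
  (∀ i, f i ≠ 0) ∧ (∀ i, f i ∈ I) ∧
    Ideal.span (Set.range fun i => mLT m (f i)) = mLTIdeal m I

/-- `g` reduces to zero modulo the family `f`. -/
def ReducesToZero (m : MonomialOrder (Fin n)) {k : ℕ} (f : Fin k → MvPolynomial (Fin n) R)
    (g : MvPolynomial (Fin n) R) : Prop :=
  ∃ p : Fin k → MvPolynomial (Fin n) R,
    g = ∑ i, p i * f i ∧
    ∀ i, p i * f i ≠ 0 → mDeg m (p i) + mDeg m (f i) ≼[m] mDeg m g

/-- A weakly regular sequence. -/
def IsWeakRegularSeq {k : ℕ} (s : Fin k → R) : Prop :=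
  ∀ i : Fin k, ∀ x : R,
    s i * x ∈ Ideal.span (s '' {j | j < i}) → x ∈ Ideal.span (s '' {j | j < i})

/-- A permutable weak regular sequence of non-units. -/
def IsPermutableWeakRegularSeq {k : ℕ} (s : Fin k → R) : Prop :=
  (∀ i, ¬ IsUnit (s i)) ∧ ∀ σ : Equiv.Perm (Fin k), IsWeakRegularSeq (s ∘ σ)

/-- `M` has a free resolution `0 → F_p → ⋯ → F_0 → M → 0` by finitely generated
free `S`-modules. -/
def HasFiniteFreeResolutionOfLength (S : Type*) [CommRing S] (M : Type*) [AddCommGroup M]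
    [Module S M] (p : ℕ) : Prop :=
  ∃ (d : ℕ → ℕ) (g : ∀ i : ℕ, (Fin (d (i + 1)) → S) →ₗ[S] (Fin (d i) → S))
    (ε : (Fin (d 0) → S) →ₗ[S] M),
    (∀ i, p < i → d i = 0) ∧
    Function.Surjective ε ∧
    LinearMap.range (g 0) = LinearMap.ker ε ∧
    ∀ i, LinearMap.range (g (i + 1)) = LinearMap.ker (g i)

/-- `M` has an infinite free resolution `⋯ → F_p → F_p → F_p → F_{p-1} → ⋯ → F_0 → M → 0`
by finitely generated free `S`-modules, whose modules are constant from stage `p` on. -/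
def HasEventuallyConstantFreeResolution (S : Type*) [CommRing S] (M : Type*) [AddCommGroup M]
    [Module S M] (p : ℕ) : Prop :=
  ∃ (d : ℕ → ℕ) (g : ∀ i : ℕ, (Fin (d (i + 1)) → S) →ₗ[S] (Fin (d i) → S))
    (ε : (Fin (d 0) → S) →ₗ[S] M),
    (∀ i, p ≤ i → d i = d p) ∧
    Function.Surjective ε ∧
    LinearMap.range (g 0) = LinearMap.ker ε ∧
    ∀ i, LinearMap.range (g (i + 1)) = LinearMap.ker (g i)

end PaperGB

open PaperGB

namespace PaperGB

section Resolution

universe u v w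

variable {R : Type u} [CommRing R]

theorem HasFiniteFreeResolutionOfLength.congr {M : Type v} {M' : Type w} [AddCommGroup M]
    [Module R M] [AddCommGroup M'] [Module R M'] {p : ℕ}
    (h : HasFiniteFreeResolutionOfLength R M p) (e : M ≃ₗ[R] M') :
    HasFiniteFreeResolutionOfLength R M' p := by
  obtain ⟨d, g, ε, hd, hε, h0, hg⟩ := h
  refine ⟨d, g, e.toLinearMap ∘ₗ ε, hd, e.surjective.comp hε, ?_, hg⟩
  rw [h0, LinearEquiv.ker_comp]

theorem HasFiniteFreeResolutionOfLength.mono {M : Type v} [AddCommGroup M] [Module R M] {p q : ℕ}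
    (h : HasFiniteFreeResolutionOfLength R M p) (hpq : p ≤ q) :
    HasFiniteFreeResolutionOfLength R M q := by
  obtain ⟨d, g, ε, hd, h⟩ := h
  exact ⟨d, g, ε, fun i hi => hd i (hpq.trans_lt hi), h⟩

theorem hasFiniteFreeResolutionOfLength_zero_iff {M : Type v} [AddCommGroup M] [Module R M] :
    HasFiniteFreeResolutionOfLength R M 0 ↔ Module.Free R M ∧ Module.Finite R M := by
  constructor
  · rintro ⟨d, g, ε, hd, hε, h0, -⟩
    have hinj : Function.Injective ε := by
      rw [← LinearMap.ker_eq_bot, ← h0, LinearMap.range_eq_bot]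
      have : IsEmpty (Fin (d (0 + 1))) := by
        rw [hd (0 + 1) (by omega)]
        infer_instance
      exact LinearMap.ext fun x => by rw [Subsingleton.elim x 0, map_zero, map_zero]
    let e := LinearEquiv.ofBijective ε ⟨hinj, hε⟩
    exact ⟨Module.Free.of_equiv e, Module.Finite.equiv e⟩
  · rintro ⟨_, _⟩
    let b := Module.Free.chooseBasis R M
    let e := b.equivFun.trans
      (LinearEquiv.funCongrLeft R R (Fintype.equivFin (Module.Free.ChooseBasisIndex R M)).symm)
    refine ⟨fun | 0 => _ | _ + 1 => 0, fun _ => 0, e.symm.toLinearMap, ?_, e.symm.surjective, ?_,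
      fun i => Subsingleton.elim (α := Submodule R (Fin 0 → R)) _ _⟩
    · rintro (_ | i) hi
      · omega
      · rfl
    · rw [LinearMap.range_zero]
      exact (LinearMap.ker_eq_bot.2 e.symm.injective).symm

theorem HasFiniteFreeResolutionOfLength.exists_surjective {M : Type v} [AddCommGroup M]
    [Module R M] {p : ℕ} (h : HasFiniteFreeResolutionOfLength R M (p + 1)) :
    ∃ (n : ℕ) (f : (Fin n → R) →ₗ[R] M), Function.Surjective f ∧
      HasFiniteFreeResolutionOfLength R (LinearMap.ker f) p := by
  obtain ⟨d, g, ε, hd, hε, h0, hg⟩ := h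
  have hmem (x) : g 0 x ∈ LinearMap.ker ε := h0 ▸ LinearMap.mem_range_self _ x
  refine ⟨d 0, ε, hε, fun i => d (i + 1), fun i => g (i + 1), (g 0).codRestrict _ hmem,
    fun i hi => hd _ (by omega), ?_, ?_, fun i => hg (i + 1)⟩
  · rintro ⟨x, hx⟩
    rw [← h0] at hx
    obtain ⟨y, rfl⟩ := hx
    exact ⟨y, rfl⟩
  · rw [LinearMap.ker_codRestrict]
    exact hg 0

theorem HasFiniteFreeResolutionOfLength.of_fin_surjective {M : Type v} [AddCommGroup M]
    [Module R M] {p n : ℕ} (f : (Fin n → R) →ₗ[R] M) (hf : Function.Surjective f)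
    (h : HasFiniteFreeResolutionOfLength R (LinearMap.ker f) p) :
    HasFiniteFreeResolutionOfLength R M (p + 1) := by
  obtain ⟨d, g, ε, hd, hε, h0, hg⟩ := h
  refine ⟨fun | 0 => n | i + 1 => d i,
    fun | 0 => (LinearMap.ker f).subtype ∘ₗ ε | i + 1 => g i, f, ?_, hf, ?_, ?_⟩
  · rintro (_ | i) hi
    · omega
    · exact hd i (by omega)
  · change LinearMap.range ((LinearMap.ker f).subtype ∘ₗ ε) = _
    rw [LinearMap.range_comp_of_range_eq_top _ (LinearMap.range_eq_top.2 hε),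
      Submodule.range_subtype]
  · rintro (_ | i)
    · change LinearMap.range (g 0) = LinearMap.ker ((LinearMap.ker f).subtype ∘ₗ ε)
      rw [h0, LinearMap.ker_comp, Submodule.ker_subtype, LinearMap.ker]
    · exact hg i

theorem HasFiniteFreeResolutionOfLength.of_surjective {F : Type w} {M : Type v} [AddCommGroup F]
    [Module R F] [Module.Free R F] [Module.Finite R F] [AddCommGroup M]
    [Module R M] {p : ℕ} (f : F →ₗ[R] M) (hf : Function.Surjective f)
    (h : HasFiniteFreeResolutionOfLength R (LinearMap.ker f) p) :
    HasFiniteFreeResolutionOfLength R M (p + 1) := by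
  let e := (Module.Free.chooseBasis R F).equivFun.trans
    (LinearEquiv.funCongrLeft R R (Fintype.equivFin (Module.Free.ChooseBasisIndex R F)).symm)
  refine of_fin_surjective (f ∘ₗ e.symm.toLinearMap) (hf.comp e.symm.surjective) (h.congr ?_)
  refine (e.submoduleMap (LinearMap.ker f)).trans (LinearEquiv.ofEq _ _ ?_)
  rw [LinearMap.ker_comp, Submodule.map_equiv_eq_comap_symm]

/-- The horseshoe lemma for finite free resolutions. -/
theorem HasFiniteFreeResolutionOfLength.of_exact {p : ℕ} {K E M : Type u} [AddCommGroup K]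
    [Module R K] [AddCommGroup E] [Module R E] [AddCommGroup M] [Module R M]
    {i : K →ₗ[R] E} {f : E →ₗ[R] M} (hi : Function.Injective i) (hif : Function.Exact i f)
    (hf : Function.Surjective f) (hK : HasFiniteFreeResolutionOfLength R K p)
    (hM : HasFiniteFreeResolutionOfLength R M p) :
    HasFiniteFreeResolutionOfLength R E p := by
  induction p generalizing K E M with
  | zero =>
    rw [hasFiniteFreeResolutionOfLength_zero_iff] at hK hM
    obtain ⟨_, _⟩ := hK
    obtain ⟨_, _⟩ := hM
    obtain ⟨l, hl⟩ := Module.projective_lifting_property f LinearMap.id hf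
    obtain ⟨e, -⟩ := hif.splitSurjectiveEquiv hi ⟨l, hl⟩
    exact hasFiniteFreeResolutionOfLength_zero_iff.2
      ⟨Module.Free.of_equiv e.symm, Module.Finite.equiv e.symm⟩
  | succ p ih =>
    obtain ⟨m, q, hq, hqK⟩ := hK.exists_surjective
    obtain ⟨n, r, hr, hrM⟩ := hM.exists_surjective
    obtain ⟨l, hl⟩ := Module.projective_lifting_property f r hf
    have hl' (y) : f (l y) = r y := LinearMap.congr_fun hl y
    have hfi (x) : f (i x) = 0 := hif.apply_apply_eq_zero x
    refine of_surjective ((i ∘ₗ q).coprod l) (fun x => ?_) ?_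
    · obtain ⟨y, hy⟩ := hr (f x)
      obtain ⟨z, hz⟩ := (hif (x - l y)).1 (by rw [map_sub, hl', hy, sub_self])
      obtain ⟨t, rfl⟩ := hq z
      exact ⟨(t, y), by simp [hz]⟩
    · refine ih (i := (LinearMap.inl R _ _).restrict (p := LinearMap.ker q) fun x hx => ?_)
        (f := (LinearMap.snd R _ _).restrict (q := LinearMap.ker r) fun x hx => ?_)
        ?_ ?_ ?_ hqK hrM
      · simp_all
      · have := congrArg f (LinearMap.mem_ker.1 hx)
        simpa [hl', hfi] using this
      · rintro x y h
        exact Subtype.ext (congrArg (fun z => z.1.1) h)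
      · rintro ⟨⟨x, y⟩, h⟩
        simp only [LinearMap.mem_ker, LinearMap.coprod_apply, LinearMap.comp_apply] at h
        constructor
        · intro hy
          obtain rfl : y = 0 := congrArg Subtype.val hy
          refine ⟨⟨x, hi ?_⟩, rfl⟩
          simpa using h
        · rintro ⟨z, hz⟩
          rw [← hz]
          rfl
      · rintro ⟨y, hy⟩
        obtain ⟨z, hz⟩ := (hif (l y)).1 (by rw [hl', hy])
        obtain ⟨t, rfl⟩ := hq z
        exact ⟨⟨(-t, y), by simp [hz]⟩, rfl⟩

/-- Adjoining an element `w` to a submodule `N`, where `N` has a resolution of length `p + 1` and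
the ideal of all `r` with `r • w ∈ N` has one of length `p`. -/
theorem HasFiniteFreeResolutionOfLength.sup_span_singleton {M : Type v} [AddCommGroup M]
    [Module R M] {p : ℕ} {N : Submodule R M} {w : M}
    (hN : HasFiniteFreeResolutionOfLength R N (p + 1))
    (hw : HasFiniteFreeResolutionOfLength R (N.comap (LinearMap.toSpanSingleton R M w)) p) :
    HasFiniteFreeResolutionOfLength R ↥(N ⊔ Submodule.span R {w}) (p + 1) := by
  obtain ⟨n, q, hq, hqK⟩ := hN.exists_surjective
  let h : (Fin n → R) × R →ₗ[R] M := (N.subtype ∘ₗ q).coprod (LinearMap.toSpanSingleton R M w)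
  have hrange : LinearMap.range h = N ⊔ Submodule.span R {w} := by
    rw [LinearMap.range_coprod, LinearMap.range_comp_of_range_eq_top _ (LinearMap.range_eq_top.2 hq),
      Submodule.range_subtype, LinearMap.range_toSpanSingleton]
  refine congr ?_ (LinearEquiv.ofEq _ _ hrange)
  refine of_surjective h.rangeRestrict h.surjective_rangeRestrict ?_
  rw [LinearMap.ker_rangeRestrict]
  refine of_exact (i := (LinearMap.inl R _ _).restrict (p := LinearMap.ker q) fun x hx => ?_)
    (f := (LinearMap.snd R _ _).restrict
      (q := N.comap (LinearMap.toSpanSingleton R M w)) fun x hx => ?_)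
    ?_ ?_ ?_ hqK hw
  · simp_all [h]
  · have hx' : (q x.1 : M) + x.2 • w = 0 := hx
    have : x.2 • w = ((-q x.1 : N) : M) := by
      rw [Submodule.coe_neg]
      exact eq_neg_of_add_eq_zero_right hx'
    simp [this]
  · rintro x y h
    exact Subtype.ext (congrArg (fun z => z.1.1) h)
  · rintro ⟨⟨x, y⟩, hxy⟩
    constructor
    · intro hy
      obtain rfl : y = 0 := congrArg Subtype.val hy
      refine ⟨⟨x, ?_⟩, rfl⟩
      simpa [h] using hxy
    · rintro ⟨z, hz⟩
      rw [← hz]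
      rfl
  · rintro ⟨y, hy⟩
    obtain ⟨t, ht⟩ := hq ⟨y • w, hy⟩
    exact ⟨⟨(-t, y), by simp [h, ht]⟩, rfl⟩

end Resolution

end PaperGB

namespace PaperGB

section Monomial

variable {R : Type*} [CommRing R] {k : ℕ}

/-- The `s`-monomial with exponent `a`. -/
def sMonomial (s : Fin k → R) (a : Fin k → ℕ) : R :=
  ∏ t, s t ^ a t

theorem sMonomial_add (s : Fin k → R) (a b : Fin k → ℕ) :
    sMonomial s (a + b) = sMonomial s a * sMonomial s b := by
  simp [sMonomial, pow_add, Finset.prod_mul_distrib]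

theorem sMonomial_zero (s : Fin k → R) : sMonomial s 0 = 1 := by
  simp [sMonomial]

theorem sMonomial_single (s : Fin k → R) (t : Fin k) :
    sMonomial s (Pi.single t 1) = s t := by
  rw [sMonomial, Finset.prod_eq_single t] <;> simp +contextual

theorem sub_single_of_eq_zero {a : Fin k → ℕ} {t : Fin k} (h : a t = 0) :
    a - Pi.single t 1 = a := by
  ext u
  by_cases hu : u = t
  · subst hu
    simp [h]
  · simp [hu]

theorem sub_single_add {a : Fin k → ℕ} {t : Fin k} (h : a t ≠ 0) :
    a - Pi.single t 1 + Pi.single t 1 = a := by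
  ext u
  by_cases hu : u = t
  · subst hu
    simp only [Pi.add_apply, Pi.sub_apply, Pi.single_eq_same]
    omega
  · simp [hu]

theorem sMonomial_eq_mul {s : Fin k → R} {a : Fin k → ℕ} {t : Fin k} (h : a t ≠ 0) :
    sMonomial s a = s t * sMonomial s (a - Pi.single t 1) := by
  rw [← sMonomial_single s t, ← sMonomial_add, add_comm, sub_single_add h]

variable {ι : Type*}

/-- The ideal generated by the `s`-monomials with exponents `α l`, `l ∈ T`. -/
def sMonomialIdeal (s : Fin k → R) (α : ι → Fin k → ℕ) (T : Finset ι) : Ideal R :=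
  Ideal.span ((fun l => sMonomial s (α l)) '' T)

theorem sMonomial_mem {s : Fin k → R} {α : ι → Fin k → ℕ} {T : Finset ι} {l : ι} (hl : l ∈ T) :
    sMonomial s (α l) ∈ sMonomialIdeal s α T :=
  Ideal.subset_span ⟨l, hl, rfl⟩

theorem sMonomialIdeal_le {s : Fin k → R} {α : ι → Fin k → ℕ} {T : Finset ι} {I : Ideal R}
    (h : ∀ l ∈ T, sMonomial s (α l) ∈ I) : sMonomialIdeal s α T ≤ I := by
  refine Ideal.span_le.2 ?_
  rintro _ ⟨l, hl, rfl⟩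
  exact h l hl

theorem sMonomialIdeal_mono {s : Fin k → R} {α : ι → Fin k → ℕ} {T T' : Finset ι} (h : T ⊆ T') :
    sMonomialIdeal s α T ≤ sMonomialIdeal s α T' :=
  sMonomialIdeal_le fun _ hl => sMonomial_mem (h hl)

theorem sMonomialIdeal_le_sub_single (s : Fin k → R) (α : ι → Fin k → ℕ) (T : Finset ι)
    (t : Fin k) : sMonomialIdeal s α T ≤ sMonomialIdeal s (fun l => α l - Pi.single t 1) T := by
  refine sMonomialIdeal_le fun l hl => ?_
  have hmem := sMonomial_mem (s := s) (α := fun l => α l - Pi.single t 1) hl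
  by_cases h : α l t = 0
  · simpa [sub_single_of_eq_zero h] using hmem
  · rw [sMonomial_eq_mul h]
    exact Ideal.mul_mem_left _ _ hmem

theorem mul_mem_sMonomialIdeal {s : Fin k → R} {α : ι → Fin k → ℕ} {T : Finset ι} {t : Fin k}
    {x : R} (hx : x ∈ sMonomialIdeal s (fun l => α l - Pi.single t 1) T) :
    s t * x ∈ sMonomialIdeal s α T := by
  suffices sMonomialIdeal s (fun l => α l - Pi.single t 1) T ≤
      Submodule.comap (LinearMap.toSpanSingleton R R (s t)) (sMonomialIdeal s α T) from by
    simpa [mul_comm] using this hx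
  refine sMonomialIdeal_le fun l hl => ?_
  rw [Submodule.mem_comap, LinearMap.toSpanSingleton_apply, smul_eq_mul, mul_comm]
  by_cases h : α l t = 0
  · rw [sub_single_of_eq_zero h]
    exact Ideal.mul_mem_left _ _ (sMonomial_mem hl)
  · rw [← sMonomial_eq_mul h]
    exact sMonomial_mem hl

theorem exists_eq_mul_add_of_mem_sMonomialIdeal {s : Fin k → R} {α : ι → Fin k → ℕ}
    {T : Finset ι} (t : Fin k) {x : R} (hx : x ∈ sMonomialIdeal s α T) :
    ∃ y ∈ sMonomialIdeal s (fun l => α l - Pi.single t 1) T,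
      ∃ z ∈ sMonomialIdeal s α (T.filter fun l => α l t = 0), x = s t * y + z := by
  refine Submodule.span_induction ?_ ?_ ?_ ?_ hx
  · rintro _ ⟨l, hl, rfl⟩
    by_cases h : α l t = 0
    · exact ⟨0, zero_mem _, _, sMonomial_mem (Finset.mem_filter.2 ⟨hl, h⟩), by simp⟩
    · exact ⟨_, sMonomial_mem hl, 0, zero_mem _, by rw [add_zero]; exact sMonomial_eq_mul h⟩
  · exact ⟨0, zero_mem _, 0, zero_mem _, by simp⟩
  · rintro _ _ - - ⟨y, hy, z, hz, rfl⟩ ⟨y', hy', z', hz', rfl⟩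
    exact ⟨y + y', add_mem hy hy', z + z', add_mem hz hz', by ring⟩
  · rintro r _ - ⟨y, hy, z, hz, rfl⟩
    exact ⟨r * y, Ideal.mul_mem_left _ _ hy, r * z, Ideal.mul_mem_left _ _ hz, by
      rw [smul_eq_mul]; ring⟩

/-- The colon ideal of `P + (monomials)` by a variable that is regular modulo `P` and the monomials
not divisible by it. -/
theorem mem_sup_sub_single_of_mul_mem {s : Fin k → R} {α : ι → Fin k → ℕ} {T : Finset ι}
    {t : Fin k} {P : Ideal R}
    (hreg : ∀ x, s t * x ∈ P ⊔ sMonomialIdeal s α (T.filter fun l => α l t = 0) →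
      x ∈ P ⊔ sMonomialIdeal s α (T.filter fun l => α l t = 0))
    {x : R} (hx : s t * x ∈ P ⊔ sMonomialIdeal s α T) :
    x ∈ P ⊔ sMonomialIdeal s (fun l => α l - Pi.single t 1) T := by
  obtain ⟨p, hp, q, hq, hpq⟩ := Submodule.mem_sup.1 hx
  obtain ⟨y, hy, z, hz, rfl⟩ := exists_eq_mul_add_of_mem_sMonomialIdeal t hq
  have hxy : x - y ∈ P ⊔ sMonomialIdeal s α (T.filter fun l => α l t = 0) := by
    refine hreg _ ?_
    rw [mul_sub, ← hpq, show p + (s t * y + z) - s t * y = p + z by ring]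
    exact Submodule.add_mem_sup hp hz
  rw [← sub_add_cancel x y]
  refine add_mem (sup_le_sup_left ?_ P hxy) (Ideal.mem_sup_right hy)
  exact (sMonomialIdeal_mono (Finset.filter_subset _ _)).trans (sMonomialIdeal_le_sub_single ..)

theorem IsPermutableWeakRegularSeq.mem_span_of_mul_mem {s : Fin k → R}
    (hs : IsPermutableWeakRegularSeq s) {S : Finset (Fin k)} {t : Fin k} (ht : t ∉ S) {x : R}
    (hx : s t * x ∈ Ideal.span (s '' S)) : x ∈ Ideal.span (s '' S) := by
  have hcard : S.card < k := by
    simpa using Finset.card_lt_univ_of_notMem ht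
  let i : Fin k := ⟨S.card, hcard⟩
  have e : {j // j < i} ≃ {j // j ∈ S} := Fintype.equivOfCardEq (by
    rw [Fintype.card_coe, Fintype.card_subtype]
    simp [i, Finset.filter_gt_eq_Iio])
  let τ := e.extendSubtype
  have hτi : τ i ∉ S := e.extendSubtype_not_mem i (lt_irrefl i)
  have hτ (j) : j < i ↔ τ j ∈ S :=
    ⟨e.extendSubtype_mem j, fun h => by_contra fun h' => e.extendSubtype_not_mem j h' h⟩
  let σ := τ.trans (Equiv.swap (τ i) t)
  have hσi : σ i = t := Equiv.swap_apply_left _ _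
  have hfix {u} (hu : u ∈ S) : Equiv.swap (τ i) t u = u :=
    Equiv.swap_apply_of_ne_of_ne (fun h => hτi (h ▸ hu)) (fun h => ht (h ▸ hu))
  have himage : (s ∘ σ) '' {j | j < i} = s '' S := by
    rw [Set.image_comp]
    congr 1
    ext u
    constructor
    · rintro ⟨j, hj, rfl⟩
      have := (hτ j).1 hj
      rw [show σ j = τ j from hfix this]
      exact this
    · intro hu
      refine ⟨τ.symm u, (hτ _).2 (by simpa using hu), ?_⟩
      simpa [σ] using hfix hu
  have := hs.2 σ i x
  rw [himage, Function.comp_apply, hσi] at this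
  exact this hx

theorem IsPermutableWeakRegularSeq.mem_sup_of_mul_mem {s : Fin k → R}
    (hs : IsPermutableWeakRegularSeq s) {α : ι → Fin k → ℕ} {T : Finset ι}
    {S : Finset (Fin k)} {t : Fin k} (ht : t ∉ S) (hα : ∀ l ∈ T, α l t = 0) {x : R}
    (hx : s t * x ∈ Ideal.span (s '' S) ⊔ sMonomialIdeal s α T) :
    x ∈ Ideal.span (s '' S) ⊔ sMonomialIdeal s α T := by
  induction hD : ∑ l ∈ T, ∑ u, α l u using Nat.strong_induction_on generalizing α T S t x with
  | _ D ih =>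
  subst hD
  by_cases hzero : ∀ l ∈ T, α l = 0
  · rcases T.eq_empty_or_nonempty with rfl | ⟨l, hl⟩
    · simp only [sMonomialIdeal, Finset.coe_empty, Set.image_empty, Ideal.span_empty,
        sup_bot_eq] at hx ⊢
      exact hs.mem_span_of_mul_mem ht hx
    · have : (1 : R) ∈ sMonomialIdeal s α T := by
        simpa [hzero l hl, sMonomial_zero] using sMonomial_mem (s := s) (α := α) hl
      rw [(Ideal.eq_top_iff_one _).2 this, sup_top_eq]
      trivial
  push Not at hzero
  obtain ⟨l₀, hl₀, hne⟩ := hzero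
  obtain ⟨u, hu⟩ := Function.ne_iff.1 hne
  rw [Pi.zero_apply] at hu
  have hut : u ≠ t := fun h => hu (h ▸ hα l₀ hl₀)
  let T' := T.filter fun l => α l u = 0
  have hT' : T' ⊆ T := Finset.filter_subset _ _
  have hα' : ∀ l ∈ T', α l t = 0 := fun l hl => hα l (hT' hl)
  have hpos : 0 < ∑ v, α l₀ v :=
    (Nat.pos_of_ne_zero hu).trans_le (Finset.single_le_sum (fun _ _ => Nat.zero_le _)
      (Finset.mem_univ u))
  have hlt : ∑ l ∈ T', ∑ v, α l v < ∑ l ∈ T, ∑ v, α l v :=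
    Finset.sum_lt_sum_of_subset hT' hl₀ (by simp [T', hu]) hpos fun _ _ _ => Nat.zero_le _
  have hle : sMonomialIdeal s α T ≤
      Ideal.span (s '' (insert u S : Finset (Fin k))) ⊔ sMonomialIdeal s α T' := by
    intro y hy
    obtain ⟨w, -, z, hz, rfl⟩ := exists_eq_mul_add_of_mem_sMonomialIdeal u hy
    refine add_mem (Ideal.mem_sup_left (Ideal.mul_mem_right _ _ (Ideal.subset_span ?_)))
      (Ideal.mem_sup_right hz)
    exact ⟨u, by simp, rfl⟩
  have hSle : Ideal.span (s '' S) ≤ Ideal.span (s '' (insert u S : Finset (Fin k))) :=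
    Ideal.span_mono (Set.image_mono (by simp))
  have hx' := ih _ hlt (S := insert u S) (by simp [ht, hut.symm]) hα'
    (sup_le (hSle.trans le_sup_left) hle hx) rfl
  have hmono : Ideal.span (s '' S) ⊔ sMonomialIdeal s α T' ≤
      Ideal.span (s '' S) ⊔ sMonomialIdeal s α T :=
    sup_le_sup_left (sMonomialIdeal_mono hT') _
  by_cases huS : u ∈ S
  · rw [Finset.insert_eq_of_mem huS] at hx'
    exact hmono hx'
  rw [Finset.coe_insert, Set.image_insert_eq, Ideal.span_insert, sup_assoc] at hx'
  obtain ⟨_, hy, z, hz, rfl⟩ := Submodule.mem_sup.1 hx'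
  obtain ⟨y, rfl⟩ := Ideal.mem_span_singleton.1 hy
  replace hz := hmono hz
  have hut' : s u * (s t * y) ∈ Ideal.span (s '' S) ⊔ sMonomialIdeal s α T := by
    rw [show s u * (s t * y) = s t * (s u * y + z) - s t * z by ring]
    exact sub_mem hx (Ideal.mul_mem_left _ _ hz)
  have hcolon := mem_sup_sub_single_of_mul_mem
    (fun w hw => ih _ hlt huS (fun l hl => (Finset.mem_filter.1 hl).2) hw rfl) hut'
  have hlt' : ∑ l ∈ T, ∑ v, (α l - Pi.single u 1 : Fin k → ℕ) v < ∑ l ∈ T, ∑ v, α l v := by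
    have hsub (l v) : (α l - Pi.single u 1 : Fin k → ℕ) v ≤ α l v := Nat.sub_le _ _
    refine Finset.sum_lt_sum (fun l _ => Finset.sum_le_sum fun v _ => hsub l v)
      ⟨l₀, hl₀, Finset.sum_lt_sum (fun v _ => hsub l₀ v) ⟨u, Finset.mem_univ u, ?_⟩⟩
    simp only [Pi.sub_apply, Pi.single_eq_same]
    omega
  have hy' := ih _ hlt' ht (fun l hl => by simp [hα l hl]) hcolon rfl
  refine add_mem ?_ hz
  obtain ⟨p, hp, q, hq, rfl⟩ := Submodule.mem_sup.1 hy'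
  rw [mul_add]
  exact Submodule.add_mem_sup (Ideal.mul_mem_left _ _ hp) (mul_mem_sMonomialIdeal hq)

theorem IsPermutableWeakRegularSeq.mem_sub_of_sMonomial_mul_mem {s : Fin k → R}
    (hs : IsPermutableWeakRegularSeq s) {α : ι → Fin k → ℕ} {T : Finset ι} {b : Fin k → ℕ} {x : R}
    (hx : sMonomial s b * x ∈ sMonomialIdeal s α T) :
    x ∈ sMonomialIdeal s (fun l => α l - b) T := by
  induction hD : ∑ u, b u generalizing α b with
  | zero =>
    obtain rfl : b = 0 := by
      ext u
      simpa using Finset.sum_eq_zero_iff.1 hD u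
    simpa [sMonomial_zero] using hx
  | succ D ih =>
    obtain ⟨u, -, hu⟩ := Finset.exists_ne_zero_of_sum_ne_zero (hD.trans_ne D.succ_ne_zero)
    rw [sMonomial_eq_mul hu, mul_assoc] at hx
    have := mem_sup_sub_single_of_mul_mem (P := Ideal.span (s '' (∅ : Finset (Fin k))))
      (fun y => hs.mem_sup_of_mul_mem (Finset.notMem_empty u)
        fun l hl => (Finset.mem_filter.1 hl).2) (Ideal.mem_sup_right hx)
    rw [Finset.coe_empty, Set.image_empty, Ideal.span_empty, bot_sup_eq] at this
    have hsub (a : Fin k → ℕ) : a - Pi.single u 1 - (b - Pi.single u 1) = a - b := by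
      rw [tsub_tsub, add_tsub_cancel_of_le]
      rw [← sub_single_add hu]
      exact le_add_self
    have h' := ih this ?_
    · simpa only [hsub] using h'
    · rw [← sub_single_add hu] at hD
      simpa [Finset.sum_add_distrib] using hD

end Monomial

end PaperGB

namespace PaperGB

section Submodule

variable {R : Type*} [CommRing R] {k : ℕ} {ι A : Type*} [DecidableEq A]

/-- The submodule generated by the `s`-monomial with exponent `α l` in coordinate `j l`, `l ∈ T`. -/
def sMonomialSubmodule (s : Fin k → R) (α : ι → Fin k → ℕ) (j : ι → A) (T : Finset ι) :
    Submodule R (A → R) :=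
  Submodule.span R ((fun l => Pi.single (j l) (sMonomial s (α l))) '' T)

theorem single_mem_sMonomialSubmodule (s : Fin k → R) (α : ι → Fin k → ℕ) (j : ι → A)
    {T : Finset ι} {l : ι} (hl : l ∈ T) :
    Pi.single (j l) (sMonomial s (α l)) ∈ sMonomialSubmodule s α j T :=
  Submodule.subset_span ⟨l, hl, rfl⟩

theorem apply_mem_of_mem_sMonomialSubmodule {s : Fin k → R} {α : ι → Fin k → ℕ} {j : ι → A}
    {T : Finset ι} {x : A → R} (hx : x ∈ sMonomialSubmodule s α j T) (i : A) :
    x i ∈ sMonomialIdeal s α (T.filter fun l => j l = i) := by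
  refine Submodule.span_induction ?_ (zero_mem _) (fun _ _ _ _ h h' => add_mem h h')
    (fun r _ _ h => Ideal.mul_mem_left _ r h) hx
  rintro _ ⟨l, hl, rfl⟩
  by_cases h : j l = i
  · subst h
    simpa using sMonomial_mem (T := T.filter fun l' => j l' = j l)
      (Finset.mem_filter.2 ⟨hl, rfl⟩)
  · simp [Pi.single_eq_of_ne' h]

theorem IsPermutableWeakRegularSeq.comap_toSpanSingleton_sMonomialSubmodule {s : Fin k → R}
    (hs : IsPermutableWeakRegularSeq s) (α : ι → Fin k → ℕ) (j : ι → A) (T : Finset ι)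
    (i : A) (b : Fin k → ℕ) :
    (sMonomialSubmodule s α j T).comap
        (LinearMap.toSpanSingleton R (A → R) (Pi.single i (sMonomial s b))) =
      sMonomialIdeal s (fun l => α l - b) (T.filter fun l => j l = i) := by
  refine le_antisymm (fun r hr => ?_) (sMonomialIdeal_le fun l hl => ?_)
  · refine hs.mem_sub_of_sMonomial_mul_mem ?_
    simpa [mul_comm] using apply_mem_of_mem_sMonomialSubmodule hr i
  · obtain ⟨hlT, rfl⟩ := Finset.mem_filter.1 hl
    have hb : α l - b + b = α l + (b - α l) := by
      ext u
      simp only [Pi.add_apply, Pi.sub_apply]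
      omega
    rw [Submodule.mem_comap, LinearMap.toSpanSingleton_apply, ← Pi.single_smul', smul_eq_mul,
      ← sMonomial_add, hb, add_comm, sMonomial_add, ← smul_eq_mul, Pi.single_smul']
    exact Submodule.smul_mem _ _ (single_mem_sMonomialSubmodule s α j hlT)

theorem map_single_sMonomialIdeal (s : Fin k → R) (α : ι → Fin k → ℕ) (T : Finset ι) (i : A) :
    Submodule.map (LinearMap.single R (fun _ : A => R) i) (sMonomialIdeal s α T) =
      sMonomialSubmodule s α (fun _ => i) T := by
  rw [sMonomialIdeal, Ideal.span, Submodule.map_span, ← Set.image_comp]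
  rfl

theorem hasFiniteFreeResolutionOfLength_zero_span_single (J : Finset A) :
    HasFiniteFreeResolutionOfLength R
      (Submodule.span R ((fun i : A => (Pi.single i 1 : A → R)) '' J)) 0 := by
  have hli : LinearIndependent R (fun i : J => (Pi.single (i : A) 1 : A → R)) :=
    (Pi.linearIndependent_single_one A R).comp _ Subtype.val_injective
  have hJ : (fun i : A => (Pi.single i 1 : A → R)) '' J =
      Set.range (fun i : J => (Pi.single (i : A) 1 : A → R)) := by
    rw [Set.image_eq_range]
    rfl
  rw [hJ, hasFiniteFreeResolutionOfLength_zero_iff]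
  exact ⟨Module.Free.of_basis (Module.Basis.span hli),
    Module.Finite.of_basis (Module.Basis.span hli)⟩

theorem IsPermutableWeakRegularSeq.hasFiniteFreeResolutionOfLength_sMonomialSubmodule
    {s : Fin k → R} (hs : IsPermutableWeakRegularSeq s) (V : Finset (Fin k))
    (α : ι → Fin k → ℕ) (j : ι → A) (T : Finset ι) (hα : ∀ l ∈ T, ∀ t ∉ V, α l t = 0) :
    HasFiniteFreeResolutionOfLength R (sMonomialSubmodule s α j T) V.card := by
  classical
  induction V using Finset.induction_on generalizing α j T with
  | empty =>
    have himage : (fun l => Pi.single (j l) (sMonomial s (α l))) '' (T : Set ι) =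
        (fun i : A => (Pi.single i 1 : A → R)) '' (T.image j : Finset A) := by
      rw [Finset.coe_image, ← Set.image_comp]
      refine Set.image_congr fun l hl => ?_
      rw [show α l = 0 from funext fun t => hα l hl t (Finset.notMem_empty t), sMonomial_zero]
      rfl
    rw [sMonomialSubmodule, himage]
    exact hasFiniteFreeResolutionOfLength_zero_span_single _
  | insert v V hv ih =>
    rw [Finset.card_insert_of_notMem hv]
    induction T using Finset.induction_on_max_value (fun l => α l v) with
    | empty =>
      exact (ih α j ∅ (by simp)).mono (Nat.le_succ _)
    | insert l₀ T hl₀ hmax ihT =>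
      have hsup : sMonomialSubmodule s α j (insert l₀ T) =
          sMonomialSubmodule s α j T ⊔
            Submodule.span R {Pi.single (j l₀) (sMonomial s (α l₀))} := by
        rw [sMonomialSubmodule, Finset.coe_insert, Set.image_insert_eq, Submodule.span_insert,
          sup_comm]
        rfl
      rw [hsup]
      refine (ihT fun l hl => hα l (Finset.mem_insert_of_mem hl)).sup_span_singleton ?_
      rw [hs.comap_toSpanSingleton_sMonomialSubmodule]
      have h := ih (fun l => α l - α l₀) (fun _ => j l₀) (T.filter fun l => j l = j l₀) ?_
      · rw [← map_single_sMonomialIdeal] at h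
        have hinj : Function.Injective (LinearMap.single R (fun _ : A => R) (j l₀)) :=
          Pi.single_injective (M := fun _ : A => R) (j l₀)
        exact h.congr (Submodule.equivMapOfInjective _ hinj _).symm
      · intro l hl t ht
        have hlT := (Finset.mem_filter.1 hl).1
        by_cases htv : t = v
        · subst htv
          exact Nat.sub_eq_zero_of_le (hmax l hlT)
        · simp [hα l (Finset.mem_insert_of_mem hlT) t (by simp [htv, ht])]

end Submodule

end PaperGB

/-- a submodule of a product module generated by terms which are units times
`s`-monomials times standard basis vectors has a finite free resolution of length ≤ k. -/
theorem finite_free_resolution_of_sMonomial_submodule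
    {R : Type*} [CommRing R] {k : ℕ} (s : Fin k → R)
    (hs : IsPermutableWeakRegularSeq s)
    (A : Type*) [DecidableEq A]
    {N : ℕ} (c : Fin N → Rˣ) (α : Fin N → Fin k → ℕ) (j : Fin N → A)
    (a : Fin N → (A → R))
    (ha : ∀ l, a l = Pi.single (j l) (↑(c l) * ∏ t, s t ^ α l t)) :
    ∃ p ≤ k, HasFiniteFreeResolutionOfLength R
      ↥(Submodule.span R (Set.range a)) p := by
  refine ⟨k, le_rfl, ?_⟩
  have h := hs.hasFiniteFreeResolutionOfLength_sMonomialSubmodule Finset.univ α j Finset.univ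
    (by simp)
  have hspan : sMonomialSubmodule s α j Finset.univ = Submodule.span R (Set.range a) := by
    have ha' (l) : a l = c l • Pi.single (j l) (sMonomial s (α l)) := by
      rw [ha, ← Pi.single_smul', Units.smul_def, smul_eq_mul, sMonomial]
    refine le_antisymm (Submodule.span_le.2 ?_) (Submodule.span_le.2 ?_)
    · rintro _ ⟨l, -, rfl⟩
      rw [SetLike.mem_coe, ← Submodule.smul_mem_iff' _ (c l), ← ha']
      exact Submodule.subset_span ⟨l, rfl⟩
    · rintro _ ⟨l, rfl⟩
      rw [SetLike.mem_coe, ha', Submodule.smul_mem_iff']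
      exact single_mem_sMonomialSubmodule s α j (Finset.mem_univ l)
  rwa [hspan, Finset.card_univ, Fintype.card_fin] at h
end

section
/- (Hilbert's syzygy theorem for a PID.) Let R be a principal ideal domain, S = R[x_1,…,x_n], and M a finitely generated S-module. Then there exist p ≤ n+1, finitely generated free S-modules F_0,…,F_p, and an exact sequence 0 → F_p → F_{p−1} → ⋯ → F_1 → F_0 → M → 0 of S-modules. -/
open MvPolynomial
open scoped MonomialOrder

open PaperGB

universe u

/-- `M` has a resolution of length at most `d` by finitely generated free `S`-modules. -/
def FreeDimLE (S : Type u) [CommRing S] :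
    ℕ → ∀ (M : Type u) [AddCommGroup M] [Module S M], Prop
  | 0, M, _, _ => Module.Free S M ∧ Module.Finite S M
  | d + 1, M, _, _ => ∃ (k : ℕ) (f : (Fin k → S) →ₗ[S] M),
      Function.Surjective f ∧ FreeDimLE S d (LinearMap.ker f)

/-- Transport of `FreeDimLE` along a semilinear equivalence. -/
theorem FreeDimLE.of_semilinearEquiv {S T : Type u} [CommRing S] [CommRing T] (σ : S ≃+* T)
    {d : ℕ} {M N : Type u} [AddCommGroup M] [Module S M] [AddCommGroup N] [Module T N]
    (e : M ≃+ N) (he : ∀ (s : S) (m : M), e (s • m) = σ s • e m) (h : FreeDimLE S d M) :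
    FreeDimLE T d N := by
  have := RingHomInvPair.of_ringEquiv σ
  have := RingHomInvPair.symm (σ : S →+* T) (σ.symm : T →+* S)
  induction d generalizing M N with
  | zero =>
    obtain ⟨h₁, h₂⟩ := h
    let e' : M ≃ₛₗ[(σ : S →+* T)] N := { e with map_smul' := he }
    exact ⟨Module.Free.of_equiv e',
      Module.Finite.of_surjective (e' : M →ₛₗ[(σ : S →+* T)] N) e'.surjective⟩
  | succ d ih =>
    obtain ⟨k, f, hf, hk⟩ := h
    let g : (Fin k → T) →ₗ[T] N :=
      { toFun := fun v => e (f fun i => σ.symm (v i))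
        map_add' := fun v w => by
          rw [← map_add, ← map_add]
          congr 2
          ext i
          simp
        map_smul' := fun t v => by
          rw [RingHom.id_apply, ← σ.apply_symm_apply t, ← he, ← map_smul]
          congr 2
          ext i
          simp }
    refine ⟨k, g, fun y => ?_, ?_⟩
    · obtain ⟨v, hv⟩ := hf (e.symm y)
      exact ⟨fun i => σ (v i), by simp [g, hv]⟩
    · refine ih (M := LinearMap.ker f) (N := LinearMap.ker g)
        { toFun := fun v => ⟨fun i => σ (v.1 i), by simp [g]⟩
          invFun := fun v => ⟨fun i => σ.symm (v.1 i), e.map_eq_zero_iff.1 v.2⟩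
          left_inv := fun v => by simp
          right_inv := fun v => by simp
          map_add' := fun v w => by ext; simp } (fun s v => ?_) hk
      ext
      simp

section

variable {S : Type u} [CommRing S] {d : ℕ} {A B C F M N : Type u}
  [AddCommGroup A] [Module S A] [AddCommGroup B] [Module S B] [AddCommGroup C] [Module S C]
  [AddCommGroup F] [Module S F] [AddCommGroup M] [Module S M] [AddCommGroup N] [Module S N]

theorem exists_equiv_fin_fun (S F : Type u) [CommRing S] [AddCommGroup F] [Module S F]
    [Module.Free S F] [Module.Finite S F] : ∃ k : ℕ, Nonempty (F ≃ₗ[S] (Fin k → S)) :=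
  ⟨_, ⟨((Module.Free.chooseBasis S F).reindex (Fintype.equivFin _)).equivFun⟩⟩

theorem FreeDimLE.of_equiv (e : M ≃ₗ[S] N) (h : FreeDimLE S d M) : FreeDimLE S d N :=
  h.of_semilinearEquiv (RingEquiv.refl S) e.toAddEquiv fun s m => map_smul e s m

/-- Dimension shifting. -/
theorem FreeDimLE.of_exact [Module.Free S F] [Module.Finite S F] (f : A →ₗ[S] F) (g : F →ₗ[S] M)
    (hf : Function.Injective f) (hg : Function.Surjective g) (hfg : Function.Exact f g)
    (h : FreeDimLE S d A) : FreeDimLE S (d + 1) M := by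
  obtain ⟨k, ⟨e⟩⟩ := exists_equiv_fin_fun S F
  refine ⟨_, g ∘ₗ e.symm.toLinearMap, hg.comp e.symm.surjective, h.of_equiv ?_⟩
  refine (LinearEquiv.ofInjective (e.toLinearMap ∘ₗ f) (e.injective.comp hf)).trans
    (LinearEquiv.ofEq _ _ ?_)
  ext v
  simp only [LinearMap.mem_range, LinearMap.mem_ker, LinearMap.comp_apply,
    LinearEquiv.coe_coe, hfg (e.symm v), Set.mem_range, ← e.eq_symm_apply]

theorem FreeDimLE.succ (h : FreeDimLE S d M) : FreeDimLE S (d + 1) M := by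
  induction d generalizing M with
  | zero =>
    obtain ⟨_, _⟩ := h
    exact of_exact (A := PUnit) 0 LinearMap.id (Function.injective_of_subsingleton _)
      Function.surjective_id (fun x => by simp [eq_comm]) ⟨inferInstance, inferInstance⟩
  | succ d ih =>
    obtain ⟨k, f, hf, hk⟩ := h
    exact ⟨k, f, hf, ih hk⟩

/-- The horseshoe lemma. -/
theorem FreeDimLE.of_extension (f : A →ₗ[S] B) (g : B →ₗ[S] C) (hf : Function.Injective f)
    (hg : Function.Surjective g) (hfg : Function.Exact f g) (hA : FreeDimLE S d A)
    (hC : FreeDimLE S d C) : FreeDimLE S d B := by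
  induction d generalizing A B C with
  | zero =>
    obtain ⟨_, _⟩ := hA
    obtain ⟨_, _⟩ := hC
    obtain ⟨s, hs⟩ := Module.projective_lifting_property g LinearMap.id hg
    let e := (hfg.splitSurjectiveEquiv hf ⟨s, hs⟩).1
    exact ⟨Module.Free.of_equiv e.symm, Module.Finite.equiv e.symm⟩
  | succ d ih =>
    obtain ⟨k, p, hp, hkp⟩ := hA
    obtain ⟨l, q, hq, hkq⟩ := hC
    obtain ⟨q', hq'⟩ := Module.projective_lifting_property g q hg
    have hgf : ∀ a, g (f a) = 0 := hfg.apply_apply_eq_zero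
    have hgq : ∀ v, g (q' v) = q v := fun v => LinearMap.congr_fun hq' v
    let r : (Fin k → S) × (Fin l → S) →ₗ[S] B := (f ∘ₗ p).coprod q'
    have hr : Function.Surjective r := fun b => by
      obtain ⟨w, hw⟩ := hq (g b)
      obtain ⟨a, ha⟩ := (hfg (b - q' w)).1 (by simp [hgq, hw])
      obtain ⟨v, rfl⟩ := hp a
      exact ⟨(v, w), by simp [r, ha]⟩
    refine of_exact (LinearMap.ker r).subtype r Subtype.val_injective hr
      (fun x => by simp) ?_
    let i : LinearMap.ker p →ₗ[S] LinearMap.ker r :=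
      (LinearMap.inl S (Fin k → S) (Fin l → S)).restrict fun x hx => by
        have hx' : p x = 0 := hx
        simp [r, hx']
    let j : LinearMap.ker r →ₗ[S] LinearMap.ker q :=
      (LinearMap.snd S (Fin k → S) (Fin l → S)).restrict fun x hx => by
        have := congrArg g (LinearMap.mem_ker.1 hx)
        simpa [r, hgf, hgq] using this
    refine ih i j ?_ ?_ ?_ hkp hkq
    · intro x y hxy
      exact Subtype.ext (congrArg (fun z => z.1.1) hxy)
    · rintro ⟨w, hw⟩
      obtain ⟨a, ha⟩ := (hfg (q' w)).1 (by rw [hgq]; exact hw)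
      obtain ⟨v, rfl⟩ := hp a
      exact ⟨⟨(-v, w), by simp [r, ha]⟩, rfl⟩
    · rintro ⟨⟨v, w⟩, hx⟩
      constructor
      · intro h
        obtain rfl : w = 0 := congrArg Subtype.val h
        refine ⟨⟨v, hf ?_⟩, rfl⟩
        simpa [r] using hx
      · rintro ⟨y, hy⟩
        rw [← hy]
        rfl

/-- The cokernel of an injective map between modules with resolutions of length at most `d` has one
of length at most `d + 1`. -/
theorem FreeDimLE.of_coker (f : A →ₗ[S] B) (g : B →ₗ[S] C) (hf : Function.Injective f)
    (hg : Function.Surjective g) (hfg : Function.Exact f g) (hA : FreeDimLE S d A)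
    (hB : FreeDimLE S d B) : FreeDimLE S (d + 1) C := by
  cases d with
  | zero =>
    obtain ⟨_, _⟩ := hB
    exact of_exact f g hf hg hfg hA
  | succ d =>
    obtain ⟨k, p, hp, hkp⟩ := hB
    refine ⟨k, g ∘ₗ p, hg.comp hp, ?_⟩
    have hi : LinearMap.ker p ≤ LinearMap.ker (g ∘ₗ p) := LinearMap.ker_le_ker_comp p g
    let e := LinearEquiv.ofInjective f hf
    let j : LinearMap.ker (g ∘ₗ p) →ₗ[S] LinearMap.range f :=
      p.restrict fun x hx => (hfg (p x)).1 hx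
    refine of_extension (Submodule.inclusion hi) (e.symm.toLinearMap ∘ₗ j)
      (Submodule.inclusion_injective hi) (e.symm.surjective.comp ?_) ?_ hkp.succ hA
    · rintro ⟨_, a, rfl⟩
      obtain ⟨v, hv⟩ := hp (f a)
      exact ⟨⟨v, by simp [hv, hfg.apply_apply_eq_zero]⟩, Subtype.ext hv⟩
    · rintro ⟨x, hx⟩
      simp only [LinearMap.comp_apply, LinearEquiv.coe_coe, EmbeddingLike.map_eq_zero_iff]
      constructor
      · intro h
        exact ⟨⟨x, congrArg Subtype.val h⟩, rfl⟩
      · rintro ⟨y, hy⟩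
        rw [← hy]
        exact Subtype.ext y.2

end

theorem PaperGB.HasFiniteFreeResolutionOfLength.of_free (S M : Type*) [CommRing S] [AddCommGroup M]
    [Module S M] [Module.Free S M] [Module.Finite S M] :
    HasFiniteFreeResolutionOfLength S M 0 := by
  let e := ((Module.Free.chooseBasis S M).reindex (Fintype.equivFin _)).equivFun
  refine ⟨fun i => match i with | 0 => _ | _ + 1 => 0, fun _ => 0, e.symm.toLinearMap,
    fun i hi => ?_, e.symm.surjective, ?_, fun i => ?_⟩
  · cases i with
    | zero => exact absurd hi (lt_irrefl 0)
    | succ i => rfl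
  · rw [LinearMap.range_zero, LinearEquiv.ker]
  · exact Subsingleton.elim (α := Submodule S (Fin 0 → S)) _ _

theorem PaperGB.HasFiniteFreeResolutionOfLength.of_ker {S M : Type*} [CommRing S] [AddCommGroup M]
    [Module S M] {k d : ℕ} (f : (Fin k → S) →ₗ[S] M) (hf : Function.Surjective f)
    (h : HasFiniteFreeResolutionOfLength S (LinearMap.ker f) d) :
    HasFiniteFreeResolutionOfLength S M (d + 1) := by
  obtain ⟨r, g, ε, hr, hε, h₀, hg⟩ := h
  refine ⟨fun i => match i with | 0 => k | i + 1 => r i,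
    fun i => match i with | 0 => (LinearMap.ker f).subtype ∘ₗ ε | i + 1 => g i, f,
    fun i hi => ?_, hf, ?_, fun i => ?_⟩
  · cases i with
    | zero => omega
    | succ i => exact hr i (by omega)
  · change LinearMap.range ((LinearMap.ker f).subtype ∘ₗ ε) = _
    rw [LinearMap.range_comp_of_range_eq_top _ (LinearMap.range_eq_top.2 hε),
      Submodule.range_subtype]
  · cases i with
    | zero =>
      change LinearMap.range (g 0) = LinearMap.ker ((LinearMap.ker f).subtype ∘ₗ ε)
      rw [h₀, LinearMap.ker_comp_of_ker_eq_bot _ (Submodule.ker_subtype _)]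
    | succ i => exact hg i

theorem FreeDimLE.hasFiniteFreeResolutionOfLength {S : Type u} [CommRing S] {d : ℕ} {M : Type u}
    [AddCommGroup M] [Module S M] (h : FreeDimLE S d M) :
    HasFiniteFreeResolutionOfLength S M d := by
  induction d generalizing M with
  | zero =>
    obtain ⟨_, _⟩ := h
    exact .of_free S M
  | succ d ih =>
    obtain ⟨k, f, hf, hk⟩ := h
    exact .of_ker f hf (ih hk)

open Polynomial TensorProduct

section

variable {R : Type u} [CommRing R]

theorem FreeDimLE.baseChange {d : ℕ} {M : Type u} [AddCommGroup M] [Module R M]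
    (h : FreeDimLE R d M) : FreeDimLE R[X] d (R[X] ⊗[R] M) := by
  induction d generalizing M with
  | zero =>
    obtain ⟨_, _⟩ := h
    exact ⟨inferInstance, inferInstance⟩
  | succ d ih =>
    obtain ⟨k, f, hf, hk⟩ := h
    refine of_exact ((LinearMap.ker f).subtype.baseChange R[X]) (f.baseChange R[X])
      (Module.Flat.lTensor_preserves_injective_linearMap _ Subtype.val_injective)
      (LinearMap.lTensor_surjective _ hf)
      (lTensor_exact R[X] (f := (LinearMap.ker f).subtype) (fun x => by simp) hf) (ih hk)

theorem exists_sum_X_pow_tmul {M : Type u} [AddCommGroup M] [Module R M] (v : R[X] ⊗[R] M) :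
    ∃ (n : ℕ) (a : ℕ → M), v = ∑ i ∈ Finset.range n, (Polynomial.X ^ i : R[X]) ⊗ₜ[R] a i := by
  let e := PolynomialModule.polynomialTensorProductLEquivPolynomialModule R M
  obtain ⟨q, rfl⟩ := e.symm.surjective v
  refine ⟨q.coeff.support.sup id + 1, q.coeff, ?_⟩
  rw [LinearEquiv.symm_apply_eq, map_sum]
  ext j
  have he (i : ℕ) (m : M) : e ((Polynomial.X ^ i : R[X]) ⊗ₜ m) = PolynomialModule.single R i m := by
    simp [e, PolynomialModule.polynomialTensorProductLEquivPolynomialModule,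
      ← monomial_one_right_eq_X_pow]
    rfl
  suffices q.coeff.support.sup id + 1 ≤ j → q.coeff j = 0 by
    simpa [he, Finsupp.single_apply, eq_comm] using this
  intro hj
  by_contra hne
  have : j ≤ q.coeff.support.sup id := Finset.le_sup (f := id) (Finsupp.mem_support_iff.2 hne)
  omega

variable {N : Type u} [AddCommGroup N] [Module R N] [Module R[X] N] [IsScalarTower R R[X] N]

/-- Multiplication by `X` on an `R[X]`-module, as an `R`-linear map. -/
noncomputable abbrev mulX : N →ₗ[R] N := Algebra.lsmul R R N (Polynomial.X : R[X])

/-- The map `p ⊗ a ↦ X p ⊗ a - p ⊗ X a`. -/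
noncomputable def charMap (B : Submodule R N) (h : B.comap mulX ≤ B) :
    R[X] ⊗[R] B.comap (mulX (R := R)) →ₗ[R[X]] R[X] ⊗[R] B :=
  (Polynomial.X : R[X]) • (Submodule.inclusion h).baseChange R[X] -
    (mulX.restrict (p := B.comap mulX) (q := B) fun _ hx => hx).baseChange R[X]

theorem charMap_tmul (B : Submodule R N) (h : B.comap mulX ≤ B) (p : R[X])
    (a : B.comap (mulX (R := R))) :
    charMap B h (p ⊗ₜ a) = (Polynomial.X * p) ⊗ₜ[R] (⟨a, h a.2⟩ : B) -
      p ⊗ₜ[R] (⟨(Polynomial.X : R[X]) • (a : N), a.2⟩ : B) := rfl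

theorem charMap_injective (B : Submodule R N) (h : B.comap mulX ≤ B) :
    Function.Injective (charMap B h) := by
  rw [injective_iff_map_eq_zero]
  intro v hv
  obtain ⟨n, a, rfl⟩ := exists_sum_X_pow_tmul v
  induction n with
  | zero => simp
  | succ n ih =>
    have hn : a n = 0 := by
      let c : R[X] ⊗[R] B →ₗ[R] B :=
        TensorProduct.lid R B ∘ₗ (Polynomial.lcoeff R (n + 1)).rTensor B
      have := congrArg c hv
      rw [map_sum, map_sum, map_zero, Finset.sum_range_succ, Finset.sum_eq_zero] at this
      · suffices h₀ : (⟨a n, h (a n).2⟩ : B) = 0 from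
          Submodule.inclusion_injective h (h₀.trans (map_zero _).symm)
        simpa [c, charMap_tmul, ← pow_succ', Polynomial.coeff_X_pow] using this
      · intro i hi
        have := Finset.mem_range.1 hi
        simp [c, charMap_tmul, ← pow_succ', Polynomial.coeff_X_pow, this.ne', show ¬ (n + 1 = i) by omega]
    rw [Finset.sum_range_succ, hn, tmul_zero, add_zero] at hv ⊢
    exact ih hv

/-- Exactness of `0 → R[X] ⊗ X⁻¹B → R[X] ⊗ B → N` in the middle. -/
theorem charMap_exact (B : Submodule R N) (h : B.comap mulX ≤ B) :
    Function.Exact (charMap B h) (B.subtype.liftBaseChange R[X]) := by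
  refine LinearMap.exact_of_comp_of_mem_range ?_ fun v hv => ?_
  · ext a
    simp [charMap_tmul]
  obtain ⟨n, b, rfl⟩ := exists_sum_X_pow_tmul v
  induction n generalizing b with
  | zero => simp
  | succ n ih =>
    let y : N := ∑ i ∈ Finset.range n, (Polynomial.X ^ i : R[X]) • (b (i + 1) : N)
    have hy : (b 0 : N) + (Polynomial.X : R[X]) • y = 0 := by
      have : ∑ i ∈ Finset.range (n + 1), (Polynomial.X ^ i : R[X]) • (b i : N) = 0 := by
        simpa using hv
      rw [← this, Finset.sum_range_succ', add_comm]
      simp [y, Finset.smul_sum, smul_smul, pow_succ']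
    have hX : (Polynomial.X : R[X]) • y = ((-b 0 : B) : N) := by
      rw [Submodule.coe_neg, eq_neg_iff_add_eq_zero, add_comm, hy]
    let a : B.comap (mulX (R := R)) := ⟨y, by
      change (Polynomial.X : R[X]) • y ∈ B
      rw [hX]
      exact (-b 0).2⟩
    let b' : ℕ → B := fun i => b (i + 1) - if i = 0 then ⟨y, h a.2⟩ else 0
    have hw : ∑ i ∈ Finset.range n, (Polynomial.X ^ i : R[X]) ⊗ₜ[R] b' i =
        (∑ i ∈ Finset.range n, (Polynomial.X ^ i : R[X]) ⊗ₜ[R] b (i + 1)) -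
          (1 : R[X]) ⊗ₜ[R] (⟨y, h a.2⟩ : B) := by
      cases n with
      | zero =>
        have : (⟨y, h a.2⟩ : B) = 0 := Subtype.ext (by simp [y])
        simp [this]
      | succ n => simp [b', Finset.sum_range_succ', tmul_sub, add_sub_assoc]
    have hφ : charMap B h (1 ⊗ₜ a) =
        (Polynomial.X : R[X]) ⊗ₜ[R] (⟨y, h a.2⟩ : B) + (1 : R[X]) ⊗ₜ[R] b 0 := by
      rw [charMap_tmul, mul_one, sub_eq_add_neg, ← tmul_neg]
      congr 2
      exact Subtype.ext (by simp [a, hX])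
    have hdecomp : ∑ i ∈ Finset.range (n + 1), (Polynomial.X ^ i : R[X]) ⊗ₜ[R] b i =
        charMap B h (1 ⊗ₜ a) +
          (Polynomial.X : R[X]) • ∑ i ∈ Finset.range n, (Polynomial.X ^ i : R[X]) ⊗ₜ[R] b' i := by
      rw [hφ, hw, Finset.sum_range_succ', smul_sub, Finset.smul_sum]
      simp only [smul_tmul', smul_eq_mul, mul_one, ← pow_succ', pow_zero]
      abel
    rw [hdecomp]
    refine add_mem (LinearMap.mem_range_self _ _) (Submodule.smul_mem _ _ (ih b' ?_))
    rw [hw]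
    simp [y]

theorem FreeDimLE.of_filtration {d : ℕ} (B : Submodule R N) (h : B.comap mulX ≤ B)
    (hB : Submodule.span R[X] (B : Set N) = ⊤) (h₁ : FreeDimLE R d (B.comap (mulX (R := R))))
    (h₂ : FreeDimLE R d B) : FreeDimLE R[X] (d + 1) N := by
  refine of_coker (charMap B h) (B.subtype.liftBaseChange R[X]) (charMap_injective B h) ?_
    (charMap_exact B h) h₁.baseChange h₂.baseChange
  rw [← LinearMap.range_eq_top, eq_top_iff, ← hB, Submodule.span_le]
  intro b hb
  exact ⟨1 ⊗ₜ ⟨b, hb⟩, by simp⟩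

end

/-- Submodules of finitely generated free `S`-modules have free resolutions of length at most
`d`. -/
def SubmoduleFreeDimLE (S : Type u) [CommRing S] (d : ℕ) : Prop :=
  ∀ (k : ℕ) (K : Submodule S (Fin k → S)), FreeDimLE S d K

theorem SubmoduleFreeDimLE.of_ringEquiv {S T : Type u} [CommRing S] [CommRing T] (σ : S ≃+* T)
    {d : ℕ} (h : SubmoduleFreeDimLE S d) : SubmoduleFreeDimLE T d := by
  intro k K
  let K' : Submodule S (Fin k → S) :=
    { carrier := {v | (fun i => σ (v i)) ∈ K}
      add_mem' := fun {v w} hv hw => by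
        have := K.add_mem hv hw
        simpa [Pi.add_def, Pi.smul_def, Pi.zero_def] using this
      zero_mem' := by
        have := K.zero_mem
        simpa [Pi.add_def, Pi.smul_def, Pi.zero_def] using this
      smul_mem' := fun s v hv => by
        have := K.smul_mem (σ s) hv
        simpa [Pi.add_def, Pi.smul_def, Pi.zero_def] using this }
  have hK' (v : K) : (fun i => σ.symm (v.1 i)) ∈ K' := by simp [K']
  refine (h k K').of_semilinearEquiv (N := K) σ
    { toFun := fun v => ⟨fun i => σ (v.1 i), v.2⟩
      invFun := fun v => ⟨fun i => σ.symm (v.1 i), hK' v⟩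
      left_inv := fun v => by ext; simp
      right_inv := fun v => by ext; simp
      map_add' := fun v w => by ext; simp } fun s v => ?_
  ext
  simp

theorem SubmoduleFreeDimLE.of_injective {R : Type u} [CommRing R] {d : ℕ}
    (h : SubmoduleFreeDimLE R d) {F M : Type u} [AddCommGroup F] [Module R F] [AddCommGroup M]
    [Module R M] [Module.Free R F] [Module.Finite R F] (f : M →ₗ[R] F)
    (hf : Function.Injective f) : FreeDimLE R d M := by
  obtain ⟨k, ⟨e⟩⟩ := exists_equiv_fin_fun R F
  exact (h _ _).of_equiv
    (LinearEquiv.ofInjective (e.toLinearMap ∘ₗ f) (e.injective.comp hf)).symm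

/-- A submodule of a free `R[X]`-module is resolved through its truncations by degree. -/
theorem SubmoduleFreeDimLE.polynomial {R : Type u} [CommRing R] [IsNoetherianRing R] {d : ℕ}
    (h : SubmoduleFreeDimLE R d) : SubmoduleFreeDimLE R[X] (d + 1) := by
  intro k K
  obtain ⟨s, hs⟩ := Module.Finite.fg_top (R := R[X]) (M := K)
  let m : ℕ := s.sup fun v => Finset.univ.sup fun i => (v.1 i).natDegree + 1
  let c : K →ₗ[R] (Fin k → R[X]) := K.subtype.restrictScalars R
  let B : Submodule R K := ⨅ i, (degreeLT R m).comap (LinearMap.proj i ∘ₗ c)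
  have hmem (v : K) : v ∈ B ↔ ∀ i, ∀ j, m ≤ j → (v.1 i).coeff j = 0 := by
    simp [B, c, Submodule.mem_iInf, mem_degreeLT, degree_lt_iff_coeff_zero]
  have hBX : B.comap mulX ≤ B := by
    intro v hv
    rw [hmem]
    intro i j hj
    have := (hmem _).1 hv i (j + 1) (by omega)
    simpa using this
  let f : B →ₗ[R] (Fin k → Fin m → R) :=
    LinearMap.pi fun i => LinearMap.pi fun j => lcoeff R j ∘ₗ LinearMap.proj i ∘ₗ c ∘ₗ B.subtype
  have hf : Function.Injective f := by
    rw [injective_iff_map_eq_zero]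
    intro v hv
    ext i j
    by_cases hj : j < m
    · exact congrFun (congrFun hv i) ⟨j, hj⟩
    · simpa using (hmem v).1 v.2 i j (by omega)
  refine FreeDimLE.of_filtration B hBX ?_ (h.of_injective (f ∘ₗ Submodule.inclusion hBX)
    (hf.comp (Submodule.inclusion_injective hBX))) (h.of_injective f hf)
  rw [eq_top_iff, ← hs]
  refine Submodule.span_mono fun v hv => (hmem v).2 fun i j hj => coeff_eq_zero_of_natDegree_lt ?_
  have h₁ : (Finset.univ.sup fun i => (v.1 i).natDegree + 1) ≤ m :=
    Finset.le_sup (f := fun v : K => Finset.univ.sup fun i => (v.1 i).natDegree + 1) hv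
  have h₂ : (v.1 i).natDegree + 1 ≤ Finset.univ.sup fun i => (v.1 i).natDegree + 1 :=
    Finset.le_sup (f := fun i => (v.1 i).natDegree + 1) (Finset.mem_univ i)
  omega

theorem SubmoduleFreeDimLE.of_isPrincipalIdealRing (R : Type u) [CommRing R] [IsDomain R]
    [IsPrincipalIdealRing R] : SubmoduleFreeDimLE R 0 :=
  fun _ _ => ⟨inferInstance, inferInstance⟩

theorem SubmoduleFreeDimLE.mvPolynomial (R : Type u) [CommRing R] [IsDomain R]
    [IsPrincipalIdealRing R] (n : ℕ) : SubmoduleFreeDimLE (MvPolynomial (Fin n) R) n := by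
  induction n with
  | zero =>
    exact (of_isPrincipalIdealRing R).of_ringEquiv (MvPolynomial.isEmptyRingEquiv R (Fin 0)).symm
  | succ n ih => exact ih.polynomial.of_ringEquiv (MvPolynomial.finSuccEquiv R n).symm.toRingEquiv

/-- Hilbert's syzygy theorem for a PID. -/
theorem hilbert_syzygy_PID
    {n : ℕ} {R : Type*} [CommRing R] [IsDomain R] [IsPrincipalIdealRing R]
    (M : Type*) [AddCommGroup M] [Module (MvPolynomial (Fin n) R) M]
    [Module.Finite (MvPolynomial (Fin n) R) M] :
    ∃ p ≤ n + 1, HasFiniteFreeResolutionOfLength (MvPolynomial (Fin n) R) M p := by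
  obtain ⟨k, f, hf⟩ := Module.Finite.exists_fin' (MvPolynomial (Fin n) R) M
  exact ⟨n + 1, le_rfl, .of_ker f hf
    (SubmoduleFreeDimLE.mvPolynomial R n k _).hasFiniteFreeResolutionOfLength⟩
end

section
/- Let R be a principal ideal domain, S = R[x_1,…,x_n], F a finitely generated free S-module, and U a submodule of F. Then there exist p ≤ n, finitely generated free S-modules F_0,…,F_p, and an exact sequence 0 → F_p → F_{p−1} → ⋯ → F_1 → F_0 → U → 0 of S-modules. -/
open MvPolynomial
open scoped MonomialOrder

open PaperGB

namespace PaperGB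

universe u

open Function Polynomial TensorProduct

/-- `M` is resolved by `p + 1` finitely generated free modules: the recursion takes the kernel of
a surjection from a finitely generated free module. -/
def FreeResolvable (S : Type u) [CommRing S] :
    ℕ → ∀ (M : Type u) [AddCommGroup M] [Module S M], Prop
  | 0, M, _, _ => Module.Free S M ∧ Module.Finite S M
  | p + 1, M, _, _ => ∃ (r : ℕ) (f : (Fin r → S) →ₗ[S] M),
      Surjective f ∧ FreeResolvable S p (LinearMap.ker f)

namespace FreeResolvable

/-- Finite free resolutions can be transported along semilinear equivalences. -/
theorem of_ringEquiv {S T : Type u} [CommRing S] [CommRing T] (e : S ≃+* T) {p : ℕ}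
    {M N : Type u} [AddCommGroup M] [Module S M] [AddCommGroup N] [Module T N]
    (g : M ≃+ N) (hg : ∀ (s : S) (m : M), g (s • m) = e s • g m)
    (hM : FreeResolvable S p M) : FreeResolvable T p N := by
  induction p generalizing M N with
  | zero =>
    obtain ⟨_, _⟩ := hM
    have := RingHomInvPair.of_ringEquiv e
    have := RingHomInvPair.of_ringEquiv e.symm
    let g' : M ≃ₛₗ[(e : S →+* T)] N := { g with map_smul' := hg }
    exact ⟨Module.Free.of_equiv g', Module.Finite.of_surjective g'.toLinearMap g.surjective⟩
  | succ p ih =>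
    obtain ⟨r, f, hf, hK⟩ := hM
    let c : (Fin r → S) ≃+ (Fin r → T) := AddEquiv.piCongrRight fun _ => e.toAddEquiv
    have hc (s : S) (v : Fin r → S) : c (s • v) = e s • c v := by
      ext i; exact map_mul e s (v i)
    have hc' (t : T) (v : Fin r → T) : c.symm (t • v) = e.symm t • c.symm v := by
      rw [AddEquiv.symm_apply_eq, hc]; simp
    let f' : (Fin r → T) →ₗ[T] N :=
      { toFun := fun v => g (f (c.symm v))
        map_add' := fun v w => by simp
        map_smul' := fun t v => by simp [hc', hg] }
    refine ⟨r, f', g.surjective.comp (hf.comp c.symm.surjective), ih ?_ ?_ hK⟩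
    · exact
        { toFun := fun v => ⟨c v, by simp [f']⟩
          invFun := fun v => ⟨c.symm v, g.injective (v.2.trans (map_zero g).symm)⟩
          map_add' := fun v w => by ext; simp
          left_inv := fun v => by simp
          right_inv := fun v => by simp }
    · exact fun s v => Subtype.ext (hc s v)

variable {S : Type u} [CommRing S] {p : ℕ}

theorem of_linearEquiv {M N : Type u} [AddCommGroup M] [Module S M] [AddCommGroup N] [Module S N]
    (g : M ≃ₗ[S] N) (hM : FreeResolvable S p M) : FreeResolvable S p N :=
  of_ringEquiv (RingEquiv.refl S) g.toAddEquiv (fun s m => g.map_smul s m) hM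

theorem exists_linearEquiv_fin_fun (M : Type u) [AddCommGroup M] [Module S M] [Module.Free S M]
    [Module.Finite S M] : ∃ r : ℕ, Nonempty (M ≃ₗ[S] (Fin r → S)) :=
  ⟨_, ⟨((Module.Free.chooseBasis S M).reindex (Fintype.equivFin _)).equivFun⟩⟩

theorem succ_of_exact {K F M : Type u} [AddCommGroup K] [Module S K] [AddCommGroup F] [Module S F]
    [Module.Free S F] [Module.Finite S F] [AddCommGroup M] [Module S M]
    {ι : K →ₗ[S] F} {π : F →ₗ[S] M} (hι : Injective ι) (h : Exact ι π) (hπ : Surjective π)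
    (hK : FreeResolvable S p K) : FreeResolvable S (p + 1) M := by
  obtain ⟨r, ⟨e⟩⟩ := exists_linearEquiv_fin_fun (S := S) F
  refine ⟨_, π ∘ₗ e.symm.toLinearMap, hπ.comp e.symm.surjective, of_linearEquiv ?_ hK⟩
  refine LinearEquiv.ofBijective
    ((e.toLinearMap ∘ₗ ι).codRestrict _ fun x => by simp [h.apply_apply_eq_zero]) ⟨?_, ?_⟩
  · exact fun x y hxy => hι (e.injective congr(($hxy).1))
  · rintro ⟨v, hv⟩
    obtain ⟨x, hx⟩ := (h _).1 hv
    exact ⟨x, Subtype.ext (e.symm_apply_eq.1 hx.symm).symm⟩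

/-- A module resolved by `p + 1` free modules is also resolved by `p + 2`. -/
theorem succ {M : Type u} [AddCommGroup M] [Module S M] (hM : FreeResolvable S p M) :
    FreeResolvable S (p + 1) M := by
  induction p generalizing M with
  | zero =>
    obtain ⟨_, _⟩ := hM
    exact succ_of_exact (ι := (0 : PUnit.{u + 1} →ₗ[S] M)) (π := LinearMap.id)
      (injective_of_subsingleton _) (by intro x; simp [eq_comm]) surjective_id
      ⟨inferInstance, inferInstance⟩
  | succ p ih =>
    obtain ⟨r, f, hf, hK⟩ := hM
    exact ⟨r, f, hf, ih hK⟩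

/-- The horseshoe lemma: finite free resolutions pass to extensions. -/
theorem of_extension {A B C : Type u} [AddCommGroup A] [Module S A] [AddCommGroup B] [Module S B]
    [AddCommGroup C] [Module S C] {ι : A →ₗ[S] B} {π : B →ₗ[S] C} (hι : Injective ι)
    (h : Exact ι π) (hπ : Surjective π) (hA : FreeResolvable S p A) (hC : FreeResolvable S p C) :
    FreeResolvable S p B := by
  induction p generalizing A B C with
  | zero =>
    obtain ⟨_, _⟩ := hA
    obtain ⟨_, _⟩ := hC
    obtain ⟨s, hs⟩ := Module.projective_lifting_property π LinearMap.id hπ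
    have hs (c : C) : π (s c) = c := LinearMap.congr_fun hs c
    let e : (A × C) ≃ₗ[S] B := LinearEquiv.ofBijective (ι.coprod s) <| by
      constructor
      · rw [← LinearMap.ker_eq_bot, LinearMap.ker_eq_bot']
        rintro ⟨a, c⟩ hac
        simp only [LinearMap.coprod_apply] at hac
        have hc : c = 0 := by simpa [h.apply_apply_eq_zero, hs] using congr(π $hac)
        subst hc
        simpa using (injective_iff_map_eq_zero ι).1 hι a (by simpa using hac)
      · intro b
        obtain ⟨a, ha⟩ := (h (b - s (π b))).1 (by simp [hs])
        exact ⟨(a, π b), by simp [ha]⟩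
    exact ⟨Module.Free.of_equiv e, Module.Finite.equiv e⟩
  | succ p ih =>
    obtain ⟨r, f, hf, hfK⟩ := hA
    obtain ⟨t, k, hk, hkK⟩ := hC
    obtain ⟨s, hs⟩ := Module.projective_lifting_property π k hπ
    have hs (c) : π (s c) = k c := LinearMap.congr_fun hs c
    have hιπ := h.apply_apply_eq_zero
    let φ := (ι ∘ₗ f).coprod s
    let α : LinearMap.ker f →ₗ[S] LinearMap.ker φ :=
      (LinearMap.inl S _ _).restrict fun a ha => by simp_all [φ]
    let β : LinearMap.ker φ →ₗ[S] LinearMap.ker k :=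
      (LinearMap.snd S _ _).restrict fun v hv => by
        simpa [φ, hιπ, hs] using congr(π $(LinearMap.mem_ker.1 hv))
    refine succ_of_exact (ι := (LinearMap.ker φ).subtype) (π := φ) Subtype.val_injective
      (LinearMap.exact_subtype_ker_map φ) ?_ (ih (ι := α) (π := β) ?_ ?_ ?_ hfK hkK)
    · intro b
      obtain ⟨c, hc⟩ := hk (π b)
      obtain ⟨a, ha⟩ := (h (b - s c)).1 (by simp [hs, hc])
      obtain ⟨a, rfl⟩ := hf a
      exact ⟨(a, c), by simp [φ, ha]⟩
    · intro x y hxy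
      exact Subtype.ext congr(($hxy).1.1)
    · rintro ⟨⟨a, c⟩, hac⟩
      constructor
      · intro h0
        obtain rfl : c = 0 := congr(($h0).1)
        refine ⟨⟨a, ?_⟩, rfl⟩
        exact (injective_iff_map_eq_zero ι).1 hι _ (by simpa [φ] using hac)
      · rintro ⟨x, hx⟩
        exact Subtype.ext congr(($hx).1.2).symm
    · rintro ⟨c, hc⟩
      obtain ⟨a, ha⟩ := (h (s c)).1 (by rw [hs]; exact hc)
      obtain ⟨a, rfl⟩ := hf a
      exact ⟨⟨(-a, c), by simp [φ, ha]⟩, rfl⟩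

/-- The resolution obtained from the mapping cone of resolutions of `ker π` and `L`. -/
theorem of_surjective {L M : Type u} [AddCommGroup L] [Module S L] [AddCommGroup M] [Module S M]
    {π : L →ₗ[S] M} (hπ : Surjective π) (hK : FreeResolvable S p (LinearMap.ker π))
    (hL : FreeResolvable S p L) : FreeResolvable S (p + 1) M := by
  cases p with
  | zero =>
    obtain ⟨_, _⟩ := hL
    exact succ_of_exact Subtype.val_injective (LinearMap.exact_subtype_ker_map π) hπ hK
  | succ p =>
    obtain ⟨r, f, hf, hfK⟩ := hL
    refine ⟨r, π ∘ₗ f, hπ.comp hf, ?_⟩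
    let α : LinearMap.ker f →ₗ[S] LinearMap.ker (π ∘ₗ f) :=
      Submodule.inclusion (LinearMap.ker_le_ker_comp f π)
    let β : LinearMap.ker (π ∘ₗ f) →ₗ[S] LinearMap.ker π := f.restrict fun v hv => hv
    refine of_extension (ι := α) (π := β) (Submodule.inclusion_injective _) ?_ ?_ hfK.succ hK
    · rintro ⟨v, hv⟩
      constructor
      · intro h0
        exact ⟨⟨v, congr(($h0).1)⟩, rfl⟩
      · rintro ⟨x, hx⟩
        exact Subtype.ext ((congrArg f congr(($hx).1)).symm.trans x.2)
    · rintro ⟨l, hl⟩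
      obtain ⟨v, rfl⟩ := hf l
      exact ⟨⟨v, hl⟩, rfl⟩

theorem baseChange (T : Type u) [CommRing T] [Algebra S T] [Module.Flat S T] {M : Type u}
    [AddCommGroup M] [Module S M] (hM : FreeResolvable S p M) :
    FreeResolvable T p (T ⊗[S] M) := by
  induction p generalizing M with
  | zero =>
    obtain ⟨_, _⟩ := hM
    exact ⟨inferInstance, inferInstance⟩
  | succ p ih =>
    obtain ⟨r, f, hf, hK⟩ := hM
    exact succ_of_exact (ι := (LinearMap.ker f).subtype.baseChange T) (π := f.baseChange T)
      (Module.Flat.lTensor_preserves_injective_linearMap _ Subtype.val_injective)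
      (lTensor_exact T (LinearMap.exact_subtype_ker_map f) hf)
      (LinearMap.baseChange_surjective T hf) (ih hK)

/-- A recursive finite free resolution, unfolded into an exact sequence. -/
theorem hasFiniteFreeResolutionOfLength {M : Type u} [AddCommGroup M] [Module S M]
    (hM : FreeResolvable S p M) : HasFiniteFreeResolutionOfLength S M p := by
  induction p generalizing M with
  | zero =>
    obtain ⟨_, _⟩ := hM
    obtain ⟨r, ⟨e⟩⟩ := exists_linearEquiv_fin_fun (S := S) M
    refine ⟨fun i => Nat.casesOn i r fun _ => 0, fun i => 0,
      e.symm.toLinearMap, ?_, e.symm.surjective, ?_, ?_⟩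
    · rintro (_ | i) hi
      · exact absurd hi (lt_irrefl 0)
      · rfl
    · simp
    · intro i
      ext x
      have : x = 0 := funext fun j => Fin.elim0 j
      simp [this]
  | succ p ih =>
    obtain ⟨r, f, hf, hK⟩ := hM
    obtain ⟨d, g, ε, hd, hε, h0, hg⟩ := ih hK
    refine ⟨fun i => Nat.casesOn i r d, fun i => match i with
      | 0 => (LinearMap.ker f).subtype ∘ₗ ε
      | i + 1 => g i, f, ?_, hf, ?_, ?_⟩
    · rintro (_ | i) hi
      · omega
      · exact hd i (by omega)
    · change LinearMap.range ((LinearMap.ker f).subtype ∘ₗ ε) = _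
      rw [LinearMap.range_comp, LinearMap.range_eq_top.2 hε, Submodule.map_top,
        Submodule.range_subtype]
    · rintro (_ | i)
      · change LinearMap.range (g 0) = LinearMap.ker ((LinearMap.ker f).subtype ∘ₗ ε)
        rw [h0, LinearMap.ker_comp_of_ker_eq_bot _ (Submodule.ker_subtype _)]
      · exact hg i

end FreeResolvable

theorem HasFiniteFreeResolutionOfLength.of_linearEquiv {S : Type*} [CommRing S] {p : ℕ}
    {M N : Type*} [AddCommGroup M] [Module S M] [AddCommGroup N] [Module S N] (e : M ≃ₗ[S] N)
    (hM : HasFiniteFreeResolutionOfLength S M p) : HasFiniteFreeResolutionOfLength S N p := by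
  obtain ⟨d, g, ε, hd, hε, h0, hg⟩ := hM
  exact ⟨d, g, e.toLinearMap ∘ₗ ε, hd, e.surjective.comp hε,
    h0.trans (LinearMap.ker_comp_of_ker_eq_bot _ e.ker).symm, hg⟩


section Polynomial

/-! Writing `U_{<N}` for `degreeLTPart U N`, there is an exact sequence
`0 → A[X] ⊗ U_{<N} → A[X] ⊗ U_{<N+1} → U → 0` of `A[X]`-modules for all large `N`. -/

variable {A : Type u} [CommRing A] {r : ℕ}

/-- The elements of `U` whose coordinates have degree less than `N`. -/
noncomputable def degreeLTPart (U : Submodule A[X] (Fin r → A[X])) (N : ℕ) : Submodule A (Fin r → A[X]) :=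
  U.restrictScalars A ⊓ Submodule.pi Set.univ fun _ => degreeLT A N

variable {U : Submodule A[X] (Fin r → A[X])} {N : ℕ}

theorem mem_degreeLTPart {v : Fin r → A[X]} :
    v ∈ degreeLTPart U N ↔ v ∈ U ∧ ∀ i j, N ≤ j → (v i).coeff j = 0 := by
  simp [degreeLTPart, Submodule.mem_pi, mem_degreeLT, degree_lt_iff_coeff_zero]

theorem degreeLTPart_freeResolvable {p : ℕ}
    (hA : ∀ (s : ℕ) (V : Submodule A (Fin s → A)), FreeResolvable A p V) :
    FreeResolvable A p (degreeLTPart U N) := by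
  let f : degreeLTPart U N →ₗ[A] (Fin (r * N) → A) :=
    { toFun := fun v k => (v.1 (finProdFinEquiv.symm k).1).coeff (finProdFinEquiv.symm k).2
      map_add' := fun v w => by ext; simp
      map_smul' := fun a v => by ext; simp }
  refine (hA _ (LinearMap.range f)).of_linearEquiv (LinearEquiv.ofInjective f ?_).symm
  rw [injective_iff_map_eq_zero]
  intro v hv
  ext i j
  by_cases hj : N ≤ j
  · simpa using (mem_degreeLTPart.1 v.2).2 i j hj
  · have hij := congrFun hv (finProdFinEquiv (i, ⟨j, not_le.1 hj⟩))
    simp only [f, LinearMap.coe_mk, AddHom.coe_mk, Equiv.symm_apply_apply] at hij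
    exact hij

variable (U N)

/-- The inclusion of `U_{<N}` in `U_{<N+1}`. -/
noncomputable def degreeLTInclusion : degreeLTPart U N →ₗ[A] degreeLTPart U (N + 1) :=
  Submodule.inclusion fun _ hv => mem_degreeLTPart.2
    ⟨(mem_degreeLTPart.1 hv).1, fun i j hj => (mem_degreeLTPart.1 hv).2 i j (by omega)⟩

/-- Multiplication by `X`, as a map from `U_{<N}` to `U_{<N+1}`. -/
noncomputable def degreeLTMulX : degreeLTPart U N →ₗ[A] degreeLTPart U (N + 1) :=
  (Algebra.lsmul A A (Fin r → A[X]) (Polynomial.X : A[X])).restrict fun v hv => mem_degreeLTPart.2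
    ⟨U.smul_mem Polynomial.X (mem_degreeLTPart.1 hv).1, fun i j hj => by
      obtain ⟨j, rfl⟩ : ∃ k, j = k + 1 := ⟨j - 1, by omega⟩
      simpa using (mem_degreeLTPart.1 hv).2 i j (by omega)⟩

/-- The evaluation map `A[X] ⊗ U_{<N} → U`. -/
noncomputable def degreeLTEval : A[X] ⊗[A] degreeLTPart U N →ₗ[A[X]] U :=
  LinearMap.liftBaseChange A[X]
    { toFun := fun v => ⟨v, (mem_degreeLTPart.1 v.2).1⟩
      map_add' := fun _ _ => rfl
      map_smul' := fun _ _ => rfl }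

/-- The map `A[X] ⊗ U_{<N} → A[X] ⊗ U_{<N+1}` sending `f ⊗ u` to `X f ⊗ u - f ⊗ X u`. -/
noncomputable def degreeLTRel :
    A[X] ⊗[A] degreeLTPart U N →ₗ[A[X]] A[X] ⊗[A] degreeLTPart U (N + 1) :=
  (Polynomial.X : A[X]) • (degreeLTInclusion U N).baseChange A[X] - (degreeLTMulX U N).baseChange A[X]

variable {U N}

@[simp]
theorem coe_degreeLTInclusion (v : degreeLTPart U N) :
    (degreeLTInclusion U N v : Fin r → A[X]) = v := by
  rw [degreeLTInclusion, Submodule.coe_inclusion]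

@[simp]
theorem coe_degreeLTMulX (v : degreeLTPart U N) :
    (degreeLTMulX U N v : Fin r → A[X]) = (Polynomial.X : A[X]) • (v : Fin r → A[X]) := by
  simp [degreeLTMulX]

@[simp]
theorem coe_degreeLTEval_tmul (f : A[X]) (v : degreeLTPart U N) :
    (degreeLTEval U N (f ⊗ₜ v) : Fin r → A[X]) = f • (v : Fin r → A[X]) := by
  simp [degreeLTEval]

@[simp]
theorem degreeLTRel_tmul (f : A[X]) (v : degreeLTPart U N) :
    degreeLTRel U N (f ⊗ₜ v) =
      (Polynomial.X * f) ⊗ₜ degreeLTInclusion U N v - f ⊗ₜ degreeLTMulX U N v := by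
  simp [degreeLTRel, smul_tmul']

theorem degreeLTEval_degreeLTRel (z : A[X] ⊗[A] degreeLTPart U N) :
    degreeLTEval U (N + 1) (degreeLTRel U N z) = 0 := by
  induction z with
  | zero => simp
  | add x y hx hy => simp [hx, hy]
  | tmul f v =>
    ext i : 2
    simp
    ring

theorem degreeLTRel_injective : Injective (degreeLTRel U N) := by
  let e (K : ℕ) := TensorProduct.equivFinsuppOfBasisLeft (N := degreeLTPart U K)
    (Polynomial.basisMonomials A)
  have hrepr (f : A[X]) (i : ℕ) : (Polynomial.basisMonomials A).repr f i = f.coeff i := rfl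
  have h0 (z) : e (N + 1) (degreeLTRel U N z) 0 = -degreeLTMulX U N (e N z 0) := by
    induction z with
    | zero => simp
    | add x y hx hy => simp only [map_add, Finsupp.add_apply, hx, hy]; abel
    | tmul f v => simp [e, hrepr]
  have h1 (z) (i : ℕ) : e (N + 1) (degreeLTRel U N z) (i + 1) =
      degreeLTInclusion U N (e N z i) - degreeLTMulX U N (e N z (i + 1)) := by
    induction z with
    | zero => simp
    | add x y hx hy => simp only [map_add, Finsupp.add_apply, hx, hy]; abel
    | tmul f v => simp [e, hrepr, Polynomial.coeff_X_mul]
  have hX {v : degreeLTPart U N} (hv : degreeLTMulX U N v = 0) : v = 0 := by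
    ext i j
    simpa using congr(($hv).1 i |>.coeff (j + 1))
  rw [injective_iff_map_eq_zero]
  intro z hz
  rw [← (e N).map_eq_zero_iff]
  ext1 i
  induction i with
  | zero => exact hX (by simpa [hz] using h0 z)
  | succ i ih => exact hX (by simpa [hz, ih] using h1 z i)

theorem sum_tmul_mem_range_degreeLTRel (d : ℕ) (m : ℕ → degreeLTPart U (N + 1))
    (a : degreeLTPart U (N + 1))
    (h : degreeLTEval U (N + 1)
      (∑ i ∈ Finset.range d, (Polynomial.X ^ i : A[X]) ⊗ₜ m i + (Polynomial.X ^ d : A[X]) ⊗ₜ a) = 0) :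
    ∑ i ∈ Finset.range d, (Polynomial.X ^ i : A[X]) ⊗ₜ m i + (Polynomial.X ^ d : A[X]) ⊗ₜ a ∈
      LinearMap.range (degreeLTRel U N) := by
  induction d generalizing a with
  | zero =>
    have ha : a = 0 := by
      ext1
      simpa using congr(($h).1)
    simp [ha]
  | succ d ih =>
    have ha : (a : Fin r → A[X]) ∈ degreeLTPart U N := by
      refine mem_degreeLTPart.2 ⟨(mem_degreeLTPart.1 a.2).1, fun k j hj => ?_⟩
      obtain rfl | hj := hj.eq_or_lt
      · have hk := congr(($h).1 k |>.coeff (N + (d + 1)))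
        simp only [map_add, map_sum, Submodule.coe_add, Submodule.coe_sum, coe_degreeLTEval_tmul,
          Pi.add_apply, Finset.sum_apply, Pi.smul_apply, smul_eq_mul, Polynomial.coeff_add, finsetSum_coeff,
          Polynomial.coeff_X_pow_mul, ZeroMemClass.coe_zero, Pi.zero_apply, Polynomial.coeff_zero] at hk
        rwa [Finset.sum_eq_zero, zero_add] at hk
        intro i hi
        have hi := Finset.mem_range.1 hi
        rw [Polynomial.coeff_X_pow_mul', if_pos (by omega)]
        exact (mem_degreeLTPart.1 (m i).2).2 k _ (by omega)
      · exact (mem_degreeLTPart.1 a.2).2 k j hj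
    let w : degreeLTPart U N := ⟨a, ha⟩
    have key : ∑ i ∈ Finset.range (d + 1), (Polynomial.X ^ i : A[X]) ⊗ₜ m i + (Polynomial.X ^ (d + 1) : A[X]) ⊗ₜ a =
        (∑ i ∈ Finset.range d, (Polynomial.X ^ i : A[X]) ⊗ₜ m i +
          (Polynomial.X ^ d : A[X]) ⊗ₜ[A] (m d + degreeLTMulX U N w)) +
        degreeLTRel U N ((Polynomial.X ^ d : A[X]) ⊗ₜ w) := by
      rw [Finset.sum_range_succ, degreeLTRel_tmul, tmul_add, ← pow_succ']
      change _ = _ + ((Polynomial.X ^ (d + 1) : A[X]) ⊗ₜ[A] a - _)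
      abel
    rw [key] at h ⊢
    refine add_mem (ih _ ?_) ⟨_, rfl⟩
    rwa [map_add, degreeLTEval_degreeLTRel, add_zero] at h

theorem range_degreeLTRel :
    LinearMap.range (degreeLTRel U N) = LinearMap.ker (degreeLTEval U (N + 1)) := by
  refine le_antisymm ?_ fun z hz => ?_
  · rintro _ ⟨z, rfl⟩
    exact degreeLTEval_degreeLTRel z
  · let e := TensorProduct.equivFinsuppOfBasisLeft (N := degreeLTPart U (N + 1))
      (Polynomial.basisMonomials A)
    obtain ⟨m, rfl⟩ := e.symm.surjective z
    obtain ⟨d, hd⟩ := m.support.exists_nat_subset_range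
    have hm : e.symm m = ∑ i ∈ Finset.range d, (Polynomial.X ^ i : A[X]) ⊗ₜ m i + (Polynomial.X ^ d : A[X]) ⊗ₜ 0 := by
      rw [tmul_zero, add_zero, TensorProduct.equivFinsuppOfBasisLeft_symm_apply,
        Finsupp.sum_of_support_subset _ hd _ (by simp)]
      simp [Polynomial.X_pow_eq_monomial]
    rw [hm] at hz ⊢
    exact sum_tmul_mem_range_degreeLTRel d m 0 hz

theorem exists_degreeLTEval_surjective [IsNoetherianRing A]
    (U : Submodule A[X] (Fin r → A[X])) : ∃ N, Surjective (degreeLTEval U (N + 1)) := by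
  obtain ⟨s, hs⟩ := (Module.Finite.fg_top : (⊤ : Submodule A[X] U).FG)
  refine ⟨s.sup fun v => Finset.univ.sup fun i => (v.1 i).natDegree, ?_⟩
  rw [← LinearMap.range_eq_top, eq_top_iff, ← hs, Submodule.span_le]
  intro v hv
  refine ⟨(1 : A[X]) ⊗ₜ ⟨v, mem_degreeLTPart.2 ⟨v.2, fun i j hj => ?_⟩⟩, ?_⟩
  · refine coeff_eq_zero_of_natDegree_lt (lt_of_lt_of_le (Nat.lt_succ_of_le ?_) hj)
    exact (Finset.le_sup (f := fun i => (v.1 i).natDegree) (Finset.mem_univ i)).trans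
      (Finset.le_sup (f := fun v : U => Finset.univ.sup fun i => (v.1 i).natDegree) hv)
  · ext1
    simp

theorem freeResolvable_polynomial [IsNoetherianRing A] {p : ℕ}
    (hA : ∀ (s : ℕ) (V : Submodule A (Fin s → A)), FreeResolvable A p V)
    (U : Submodule A[X] (Fin r → A[X])) : FreeResolvable A[X] (p + 1) U := by
  obtain ⟨N, hN⟩ := exists_degreeLTEval_surjective U
  refine FreeResolvable.of_surjective hN ?_ ((degreeLTPart_freeResolvable hA).baseChange A[X])
  exact ((degreeLTPart_freeResolvable hA).baseChange A[X]).of_linearEquiv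
    ((LinearEquiv.ofInjective _ degreeLTRel_injective).trans
      (LinearEquiv.ofEq _ _ range_degreeLTRel))

end Polynomial

theorem freeResolvable_submodule_of_ringEquiv {S T : Type u} [CommRing S] [CommRing T]
    (e : T ≃+* S) {p : ℕ} (hT : ∀ (s : ℕ) (V : Submodule T (Fin s → T)), FreeResolvable T p V)
    {r : ℕ} (U : Submodule S (Fin r → S)) : FreeResolvable S p U := by
  let V : Submodule T (Fin r → T) :=
    { carrier := {v | (fun i => e (v i)) ∈ U}
      add_mem' := fun {v w} hv hw => by
        simpa [Pi.add_def] using U.add_mem hv hw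
      zero_mem' := by simpa [Pi.zero_def] using U.zero_mem
      smul_mem' := fun t v hv => by
        simpa [Pi.smul_def] using U.smul_mem (e t) hv }
  let g : V ≃+ U :=
    { toFun := fun v => ⟨fun i => e (v.1 i), v.2⟩
      invFun := fun u => ⟨fun i => e.symm (u.1 i), by simp [V]⟩
      map_add' := fun v w => by ext; simp
      left_inv := fun v => by ext; simp
      right_inv := fun v => by ext; simp }
  exact (hT r V).of_ringEquiv e g fun t v => by ext; simp [g]

theorem freeResolvable_submodule_mvPolynomial (R : Type u) [CommRing R] [IsDomain R]
    [IsPrincipalIdealRing R] (n : ℕ) {r : ℕ}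
    (U : Submodule (MvPolynomial (Fin n) R) (Fin r → MvPolynomial (Fin n) R)) :
    FreeResolvable (MvPolynomial (Fin n) R) n U := by
  induction n generalizing r with
  | zero =>
    have : IsPrincipalIdealRing (MvPolynomial (Fin 0) R) :=
      .of_surjective (MvPolynomial.isEmptyRingEquiv R (Fin 0)).symm.toRingHom
        (MvPolynomial.isEmptyRingEquiv R (Fin 0)).symm.surjective
    exact ⟨inferInstance, inferInstance⟩
  | succ n ih =>
    exact freeResolvable_submodule_of_ringEquiv
      (MvPolynomial.finSuccEquiv R n).symm.toRingEquiv
      (fun _ => freeResolvable_polynomial fun _ => ih) U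

end PaperGB

/-- a submodule of a finitely generated free module over `R[x_1,…,x_n]`
(`R` a PID) has a finite free resolution of length at most `n`. -/
theorem submodule_free_resolution_PID
    {n : ℕ} {R : Type*} [CommRing R] [IsDomain R] [IsPrincipalIdealRing R]
    (F : Type*) [AddCommGroup F] [Module (MvPolynomial (Fin n) R) F]
    [Module.Free (MvPolynomial (Fin n) R) F] [Module.Finite (MvPolynomial (Fin n) R) F]
    (U : Submodule (MvPolynomial (Fin n) R) F) :
    ∃ p ≤ n, HasFiniteFreeResolutionOfLength (MvPolynomial (Fin n) R) ↥U p := by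
  obtain ⟨r, ⟨b⟩⟩ : ∃ r : ℕ, Nonempty
      (F ≃ₗ[MvPolynomial (Fin n) R] (Fin r → MvPolynomial (Fin n) R)) :=
    ⟨_, ⟨(Module.finBasis (MvPolynomial (Fin n) R) F).equivFun⟩⟩
  exact ⟨n, le_rfl, (freeResolvable_submodule_mvPolynomial R n
    (U.map b.toLinearMap)).hasFiniteFreeResolutionOfLength.of_linearEquiv
      (b.submoduleMap U).symm⟩
end

section
/- (Buchberger's criterion for a quotient of a PID.) Let R be a principal ideal domain, N = p_1^{n_1}⋯p_k^{n_k} ∈ R a nonzero non-unit with pairwise non-associate irreducible factors p_i, R̄ = R/NR, and S = R̄[x_1,…,x_n] with a fixed monomial order. Let G = {f_1,…,f_m} be nonzero elements of S and U the ideal they generate. Then G is a Gröbner basis of U if and only if for each i the element ann(lc(f_i))·f_i reduces to zero modulo G, and for every 1 ≤ i < j ≤ m the element S_{R̄}(f_i,f_j) reduces to zero modulo G. -/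
open MvPolynomial
open scoped MonomialOrder

open PaperGB

/-- The `S_{R/NR}`-polynomial of `f i`, `f j` over `R/NR`, where
`lc (f i) = v i * (∏ t, p t ^ α i t + NR)`. -/
noncomputable def sPolyQuot {n : ℕ} {R : Type*} [CommRing R] (N : R)
    (m : MonomialOrder (Fin n)) {k M : ℕ} (p : Fin k → R)
    (f : Fin M → MvPolynomial (Fin n) (R ⧸ Ideal.span {N}))
    (v : Fin M → (R ⧸ Ideal.span {N})ˣ) (α : Fin M → Fin k → ℕ) (i j : Fin M) :
    MvPolynomial (Fin n) (R ⧸ Ideal.span {N}) :=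
  MvPolynomial.monomial ((mDeg m (f i) ⊔ mDeg m (f j)) - mDeg m (f i))
      (↑(v i)⁻¹ * Ideal.Quotient.mk (Ideal.span {N})
        (∏ t, p t ^ (max (α i t) (α j t) - α i t))) * f i
  - MvPolynomial.monomial ((mDeg m (f i) ⊔ mDeg m (f j)) - mDeg m (f j))
      (↑(v j)⁻¹ * Ideal.Quotient.mk (Ideal.span {N})
        (∏ t, p t ^ (max (α i t) (α j t) - α j t))) * f j

namespace PaperGB

section StandardRepresentations

variable {n M : ℕ} {A : Type*} [CommRing A] (m : MonomialOrder (Fin n))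
  (f : Fin M → MvPolynomial (Fin n) A)

/-- The `A`-combinations of the products `x^d * f i` with `d + deg (f i)` in the set `B`. -/
noncomputable def boundedSpan (B : Set m.syn) : Submodule A (MvPolynomial (Fin n) A) :=
  Submodule.span A {g | ∃ i d, m.toSyn (d + m.degree (f i)) ∈ B ∧ g = monomial d 1 * f i}

variable {m f}

theorem boundedSpan_mono {B B' : Set m.syn} (h : B ⊆ B') :
    boundedSpan m f B ≤ boundedSpan m f B' :=
  Submodule.span_mono fun _ ⟨i, d, hd, hg⟩ => ⟨i, d, h hd, hg⟩

theorem monomial_mul_mem_boundedSpan {B : Set m.syn} {i : Fin M} {d : Fin n →₀ ℕ}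
    (h : m.toSyn (d + m.degree (f i)) ∈ B) (c : A) :
    monomial d c * f i ∈ boundedSpan m f B := by
  have : monomial d c * f i = c • (monomial d 1 * f i) := by
    rw [← smul_mul_assoc, smul_monomial, smul_eq_mul, mul_one]
  rw [this]
  exact Submodule.smul_mem _ _ (Submodule.subset_span ⟨i, d, h, rfl⟩)

theorem mem_boundedSpan_iff {B : Set m.syn} {g : MvPolynomial (Fin n) A} :
    g ∈ boundedSpan m f B ↔ ∃ q : Fin M → MvPolynomial (Fin n) A,
      g = ∑ i, q i * f i ∧ ∀ i, ∀ d ∈ (q i).support, m.toSyn (d + m.degree (f i)) ∈ B := by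
  classical
  constructor
  · intro hg
    induction hg using Submodule.span_induction with
    | mem x hx =>
      obtain ⟨i, d, hd, rfl⟩ := hx
      refine ⟨Pi.single i (monomial d 1), ?_, fun j e he => ?_⟩
      · rw [Finset.sum_eq_single i]
        · simp
        · intro j _ hj
          simp [Pi.single_eq_of_ne hj]
        · simp
      · rcases eq_or_ne j i with rfl | hj
        · rw [Pi.single_eq_same] at he
          rwa [Finset.mem_singleton.1 (support_monomial_subset he)]
        · simp [Pi.single_eq_of_ne hj] at he
    | zero => exact ⟨0, by simp, by simp⟩
    | add x y _ _ hx hy =>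
      obtain ⟨q, rfl, hq⟩ := hx
      obtain ⟨r, rfl, hr⟩ := hy
      refine ⟨q + r, by simp [add_mul, Finset.sum_add_distrib], fun i d hd => ?_⟩
      rcases Finset.mem_union.1 (support_add hd) with h | h
      exacts [hq i d h, hr i d h]
    | smul c x _ hx =>
      obtain ⟨q, rfl, hq⟩ := hx
      exact ⟨c • q, by simp [Finset.smul_sum], fun i d hd => hq i d (support_smul hd)⟩
  · rintro ⟨q, rfl, hq⟩
    refine Submodule.sum_mem _ fun i _ => ?_
    rw [(q i).as_sum, Finset.sum_mul]
    exact Submodule.sum_mem _ fun d hd => monomial_mul_mem_boundedSpan (hq i d hd) _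

theorem monomial_mul_mem_boundedSpan_Iio {e d : Fin n →₀ ℕ} {g : MvPolynomial (Fin n) A}
    (hg : g ∈ boundedSpan m f (Set.Iio (m.toSyn e))) (c : A) :
    monomial d c * g ∈ boundedSpan m f (Set.Iio (m.toSyn (d + e))) := by
  induction hg using Submodule.span_induction with
  | mem x hx =>
    obtain ⟨i, d', hd, rfl⟩ := hx
    rw [← mul_assoc, monomial_mul]
    apply monomial_mul_mem_boundedSpan
    rw [add_assoc, Set.mem_Iio, map_add, map_add m.toSyn d e]
    simpa only [add_lt_add_iff_left] using Set.mem_Iio.1 hd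
  | zero => simp
  | add x y _ _ hx hy => rw [mul_add]; exact Submodule.add_mem _ hx hy
  | smul a x _ hx => rw [mul_smul_comm]; exact Submodule.smul_mem _ _ hx

theorem mem_ideal_span_of_mem_boundedSpan {B : Set m.syn} {g : MvPolynomial (Fin n) A}
    (hg : g ∈ boundedSpan m f B) : g ∈ Ideal.span (Set.range f) := by
  obtain ⟨q, rfl, -⟩ := mem_boundedSpan_iff.1 hg
  exact Ideal.sum_mem _ fun i _ => Ideal.mul_mem_left _ _ (Ideal.subset_span ⟨i, rfl⟩)

theorem mem_boundedSpan_univ {g : MvPolynomial (Fin n) A}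
    (hg : g ∈ Ideal.span (Set.range f)) : g ∈ boundedSpan m f Set.univ := by
  obtain ⟨q, rfl⟩ := Ideal.mem_span_range_iff_exists_fun.1 hg
  exact mem_boundedSpan_iff.2 ⟨q, rfl, fun _ _ _ => Set.mem_univ _⟩

theorem eq_zero_or_exists_mem_boundedSpan_Iic {B : Set m.syn} {g : MvPolynomial (Fin n) A}
    (hg : g ∈ boundedSpan m f B) : g = 0 ∨ ∃ D ∈ B, g ∈ boundedSpan m f (Set.Iic D) := by
  induction hg using Submodule.span_induction with
  | mem x hx =>
    obtain ⟨i, d, hd, rfl⟩ := hx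
    exact Or.inr ⟨_, hd, monomial_mul_mem_boundedSpan (Set.mem_Iic.2 le_rfl) _⟩
  | zero => exact Or.inl rfl
  | add x y _ _ hx hy =>
    rcases hx with rfl | ⟨D, hD, hx⟩
    · simpa using hy
    rcases hy with rfl | ⟨E, hE, hy⟩
    · exact Or.inr ⟨D, hD, by simpa using hx⟩
    refine Or.inr ⟨max D E, ?_, Submodule.add_mem _ (boundedSpan_mono ?_ hx)
      (boundedSpan_mono ?_ hy)⟩
    · rcases max_choice D E with h | h <;> rwa [h]
    · exact Set.Iic_subset_Iic.2 (le_max_left _ _)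
    · exact Set.Iic_subset_Iic.2 (le_max_right _ _)
  | smul c x _ hx =>
    rcases hx with rfl | ⟨D, hD, hx⟩
    · simp
    · exact Or.inr ⟨D, hD, Submodule.smul_mem _ _ hx⟩

theorem reducesToZero_iff {g : MvPolynomial (Fin n) A} :
    ReducesToZero m f g ↔ g ∈ boundedSpan m f (Set.Iic (m.toSyn (m.degree g))) := by
  classical
  rw [mem_boundedSpan_iff]
  constructor
  · rintro ⟨q, hg, hq⟩
    refine ⟨fun i => if q i * f i = 0 then 0 else q i, ?_, fun i d hd => ?_⟩
    · refine hg.trans (Finset.sum_congr rfl fun i _ => ?_)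
      dsimp only
      split_ifs with h <;> simp [h]
    · dsimp only at hd
      split_ifs at hd with h
      · simp at hd
      · refine le_trans ?_ (hq i h)
        rw [map_add, map_add]
        exact add_le_add_left (m.le_degree hd) _
  · rintro ⟨q, hg, hq⟩
    refine ⟨q, hg, fun i hi => hq i _ (m.degree_mem_support ?_)⟩
    rintro h
    simp [h] at hi

theorem eq_zero_or_degree_lt {h : MvPolynomial (Fin n) A} {e : Fin n →₀ ℕ}
    (hle : m.degree h ≼[m] e) (hc : h.coeff e = 0) : h = 0 ∨ m.degree h ≺[m] e := by
  rcases hle.lt_or_eq with hlt | heq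
  · exact Or.inr hlt
  · rw [← m.toSyn.injective heq] at hc
    exact Or.inl (m.leadingCoeff_eq_zero_iff.1 hc)

theorem mem_boundedSpan_Iio {h : MvPolynomial (Fin n) A} {e : Fin n →₀ ℕ}
    (hle : m.degree h ≼[m] e) (hc : h.coeff e = 0) (hred : ReducesToZero m f h) :
    h ∈ boundedSpan m f (Set.Iio (m.toSyn e)) := by
  rcases eq_zero_or_degree_lt hle hc with rfl | hlt
  · exact Submodule.zero_mem _
  · exact boundedSpan_mono (fun x hx => lt_of_le_of_lt hx hlt) (reducesToZero_iff.1 hred)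

theorem degree_monomial_mul_le {g : MvPolynomial (Fin n) A} {e : Fin n →₀ ℕ}
    (h : m.degree g ≤ e) (c : A) :
    m.degree (monomial (e - m.degree g) c * g) ≼[m] e := by
  refine m.degree_mul_le.trans ?_
  conv_rhs => rw [← tsub_add_cancel_of_le h]
  rw [map_add, map_add]
  exact add_le_add_left (m.degree_monomial_le c) _

theorem coeff_monomial_mul_eq {g : MvPolynomial (Fin n) A} {e : Fin n →₀ ℕ}
    (h : m.degree g ≤ e) (c : A) :
    (monomial (e - m.degree g) c * g).coeff e = c * m.leadingCoeff g := by
  conv_lhs => rw [← tsub_add_cancel_of_le h, add_tsub_cancel_right]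
  rw [coeff_monomial_mul, MonomialOrder.leadingCoeff]

theorem coeff_eq_zero_of_mem_boundedSpan_Iio {g : MvPolynomial (Fin n) A} {e : Fin n →₀ ℕ}
    (hg : g ∈ boundedSpan m f (Set.Iio (m.toSyn e))) : g.coeff e = 0 := by
  induction hg using Submodule.span_induction with
  | mem x hx =>
    obtain ⟨i, d, hd, rfl⟩ := hx
    refine m.coeff_eq_zero_of_lt (lt_of_le_of_lt (m.degree_mul_le.trans ?_) hd)
    rw [map_add, map_add]
    exact add_le_add_left (m.degree_monomial_le 1) _
  | zero => simp
  | add x y _ _ hx hy => simp [hx, hy]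
  | smul c x _ hx => simp [hx]

variable (f) in
theorem exists_top_coefficients {g : MvPolynomial (Fin n) A} {e : Fin n →₀ ℕ}
    (hg : g ∈ boundedSpan m f (Set.Iic (m.toSyn e))) :
    ∃ c : Fin M → A, (∀ i, ¬ m.degree (f i) ≤ e → c i = 0) ∧
      g - ∑ i, monomial (e - m.degree (f i)) (c i) * f i ∈
        boundedSpan m f (Set.Iio (m.toSyn e)) := by
  classical
  induction hg using Submodule.span_induction with
  | mem x hx =>
    obtain ⟨i, d, hd, rfl⟩ := hx
    rcases (Set.mem_Iic.1 hd).lt_or_eq with hlt | heq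
    · exact ⟨0, by simp, by simpa using monomial_mul_mem_boundedSpan hlt 1⟩
    · obtain rfl := m.toSyn.injective heq
      refine ⟨Pi.single i 1, fun j hj => Pi.single_eq_of_ne ?_ _, ?_⟩
      · rintro rfl
        exact hj le_add_self
      · rw [Finset.sum_eq_single i]
        · simp
        · intro j _ hj
          simp [Pi.single_eq_of_ne hj]
        · simp
  | zero => exact ⟨0, by simp, by simp⟩
  | add x y _ _ hx hy =>
    obtain ⟨c, hc, hx⟩ := hx
    obtain ⟨d, hd, hy⟩ := hy
    refine ⟨c + d, fun i hi => by simp [hc i hi, hd i hi], ?_⟩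
    convert Submodule.add_mem _ hx hy using 1
    simp only [Pi.add_apply, map_add, add_mul, Finset.sum_add_distrib]
    ring
  | smul a x _ hx =>
    obtain ⟨c, hc, hx⟩ := hx
    refine ⟨a • c, fun i hi => by simp [hc i hi], ?_⟩
    convert Submodule.smul_mem _ a hx using 1
    simp only [smul_sub, Finset.smul_sum, ← smul_mul_assoc, smul_monomial, Pi.smul_apply]

theorem coeff_sum_monomial_mul {e : Fin n →₀ ℕ} {c : Fin M → A}
    (hc : ∀ i, ¬ m.degree (f i) ≤ e → c i = 0) :
    (∑ i, monomial (e - m.degree (f i)) (c i) * f i).coeff e =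
      ∑ i, c i * m.leadingCoeff (f i) := by
  rw [coeff_sum]
  refine Finset.sum_congr rfl fun i _ => ?_
  by_cases h : m.degree (f i) ≤ e
  · exact coeff_monomial_mul_eq h _
  · simp [hc i h]

theorem mem_boundedSpan_of_leadingTerms
    (hG : Ideal.span (Set.range fun i => mLT m (f i)) = mLTIdeal m (Ideal.span (Set.range f)))
    {g : MvPolynomial (Fin n) A} (hg : g ∈ Ideal.span (Set.range f)) :
    g ∈ boundedSpan m f (Set.Iic (m.toSyn (m.degree g))) := by
  classical
  induction hD : m.toSyn (m.degree g) using WellFoundedLT.induction generalizing g with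
  | ind D ih =>
  subst hD
  by_cases hg0 : g = 0
  · rw [hg0]; exact Submodule.zero_mem _
  have hLT : mLT m g ∈ Ideal.span (Set.range fun i => mLT m (f i)) := by
    rw [hG]; exact Ideal.subset_span ⟨g, ⟨hg, hg0⟩, rfl⟩
  obtain ⟨q, hq⟩ := Ideal.mem_span_range_iff_exists_fun.1 hLT
  let c : Fin M → A := fun i =>
    if m.degree (f i) ≤ m.degree g then (q i).coeff (m.degree g - m.degree (f i)) else 0
  have hc : ∀ i, ¬ m.degree (f i) ≤ m.degree g → c i = 0 := fun i hi => if_neg hi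
  have hlc : ∑ i, c i * m.leadingCoeff (f i) = g.coeff (m.degree g) := by
    have h := congrArg (coeff (m.degree g)) hq
    rw [coeff_sum] at h
    calc _ = _ := Finset.sum_congr rfl fun i _ => ?_
      _ = _ := h
      _ = _ := coeff_monomial _ _ _ |>.trans (if_pos rfl)
    change _ = coeff (m.degree g) (q i * monomial (m.degree (f i)) (m.leadingCoeff (f i)))
    rw [coeff_mul_monomial']
    by_cases hi : m.degree (f i) ≤ m.degree g <;> simp [c, hi]
  have hmem : ∑ i, monomial (m.degree g - m.degree (f i)) (c i) * f i ∈
      boundedSpan m f (Set.Iic (m.toSyn (m.degree g))) := by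
    refine Submodule.sum_mem _ fun i _ => ?_
    by_cases hi : m.degree (f i) ≤ m.degree g
    · refine monomial_mul_mem_boundedSpan ?_ _
      rw [tsub_add_cancel_of_le hi]
      exact Set.mem_Iic.2 le_rfl
    · simp [hc i hi]
  refine (Submodule.sub_mem_iff_left _ hmem).1 ?_
  have hle : m.degree (g - ∑ i, monomial (m.degree g - m.degree (f i)) (c i) * f i) ≼[m]
      m.degree g := by
    refine m.degree_sub_le.trans (sup_le le_rfl (m.degree_sum_le.trans ?_))
    refine Finset.sup_le fun i _ => ?_
    by_cases hi : m.degree (f i) ≤ m.degree g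
    · exact degree_monomial_mul_le hi _
    · simp [hc i hi]
  have hzero : (g - ∑ i, monomial (m.degree g - m.degree (f i)) (c i) * f i).coeff
      (m.degree g) = 0 := by
    rw [coeff_sub, coeff_sum_monomial_mul hc, hlc, sub_self]
  rcases eq_zero_or_degree_lt hle hzero with h0 | hlt
  · rw [h0]; exact Submodule.zero_mem _
  · exact boundedSpan_mono (Set.Iic_subset_Iic.2 hlt.le)
      (ih _ hlt (sub_mem hg (mem_ideal_span_of_mem_boundedSpan hmem)) rfl)

theorem mLT_mem_span_of_syzygies
    (hsyz : ∀ (e : Fin n →₀ ℕ) (c : Fin M → A), (∀ i, ¬ m.degree (f i) ≤ e → c i = 0) →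
      ∑ i, c i * m.leadingCoeff (f i) = 0 →
      ∑ i, monomial (e - m.degree (f i)) (c i) * f i ∈ boundedSpan m f (Set.Iio (m.toSyn e)))
    {g : MvPolynomial (Fin n) A} (hg : g ∈ Ideal.span (Set.range f)) (hg0 : g ≠ 0) :
    mLT m g ∈ Ideal.span (Set.range fun i => mLT m (f i)) := by
  obtain ⟨D, -, hD⟩ := (eq_zero_or_exists_mem_boundedSpan_Iic
    (mem_boundedSpan_univ (m := m) hg)).resolve_left hg0
  induction D using WellFoundedLT.induction with
  | ind D ih =>
  obtain ⟨e, rfl⟩ := m.toSyn.surjective D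
  obtain ⟨c, hc, hrest⟩ := exists_top_coefficients f hD
  have hcoeff : g.coeff e = ∑ i, c i * m.leadingCoeff (f i) := by
    have := coeff_eq_zero_of_mem_boundedSpan_Iio hrest
    rwa [coeff_sub, coeff_sum_monomial_mul hc, sub_eq_zero] at this
  by_cases h0 : g.coeff e = 0
  · have hlt := Submodule.add_mem _ hrest (hsyz e c hc (hcoeff ▸ h0))
    rw [sub_add_cancel] at hlt
    obtain ⟨D', hD', hgD'⟩ := (eq_zero_or_exists_mem_boundedSpan_Iic hlt).resolve_left hg0
    exact ih D' hD' hgD'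
  · have hdeg : m.degree g = e := by
      refine m.toSyn.injective (le_antisymm ?_ (m.le_degree (mem_support_iff.2 h0)))
      by_contra! hlt
      refine hg0 (m.leadingCoeff_eq_zero_iff.1 ?_)
      exact coeff_eq_zero_of_mem_boundedSpan_Iio (m := m) (f := f)
        (boundedSpan_mono (fun x hx => lt_of_le_of_lt hx hlt) hD)
    have : mLT m g = ∑ i, monomial (e - m.degree (f i)) (c i) * mLT m (f i) := by
      change monomial (m.degree g) (g.coeff (m.degree g)) = _
      rw [hdeg, hcoeff, map_sum]
      refine Finset.sum_congr rfl fun i _ => ?_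
      change _ = _ * monomial (m.degree (f i)) (m.leadingCoeff (f i))
      rw [monomial_mul]
      by_cases hi : m.degree (f i) ≤ e
      · rw [tsub_add_cancel_of_le hi]
      · simp [hc i hi]
    rw [this]
    exact Ideal.sum_mem _ fun i _ => Ideal.mul_mem_left _ _ (Ideal.subset_span ⟨i, rfl⟩)

end StandardRepresentations

section Syzygies

/-- In a principal ideal ring, the intersection of `(b)` with a finitely generated ideal `∑ (a i)`
is the sum of the ideals `(a i) ∩ (b)`. -/
theorem exists_sum_eq_of_dvd_of_mem_span {A ι : Type*} [CommRing A] [IsPrincipalIdealRing A]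
    (s : Finset ι) (a c : ι → A) {b x : A} (hx : x = ∑ i ∈ s, c i * a i) (hb : b ∣ x) :
    ∃ y z : ι → A, x = ∑ i ∈ s, y i * a i ∧ ∀ i ∈ s, y i * a i = z i * b := by
  obtain ⟨g, hg⟩ := (IsPrincipalIdealRing.principal (Ideal.span (a '' s))).principal
  rw [Ideal.submodule_span_eq] at hg
  have hag : ∀ i ∈ s, ∃ a', a i = g * a' := fun i hi =>
    Ideal.mem_span_singleton.1 (hg ▸ Ideal.subset_span ⟨i, hi, rfl⟩)
  choose! a' ha' using hag
  have hgs : g ∈ Ideal.span (a '' s) := hg ▸ Ideal.mem_span_singleton_self g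
  obtain ⟨u, hu⟩ := (Submodule.mem_span_image_finset_iff_exists_fun' A).1 hgs
  obtain ⟨w, hw⟩ : g ∣ x := hx ▸ Finset.dvd_sum fun i hi =>
    Dvd.dvd.mul_left ⟨a' i, ha' i hi⟩ _
  obtain ⟨r, hr⟩ := hb
  refine ⟨fun i => u i * w, fun i => u i * a' i * r, ?_, fun i hi => ?_⟩
  · rw [hw]
    nth_rewrite 1 [← hu]
    rw [Finset.sum_mul]
    exact Finset.sum_congr rfl fun i _ => by rw [smul_eq_mul]; ring
  · calc u i * w * a i = u i * a' i * (g * w) := by rw [ha' i hi]; ring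
      _ = _ := by rw [← hw, hr]; ring

/-- Over a principal ideal ring, all syzygies are generated by those supported on two indices. -/
theorem sum_smul_mem_of_pairwise {A ι W : Type*} [CommRing A] [IsPrincipalIdealRing A]
    [AddCommGroup W] [Module A W] (Q : Submodule A W) (s : Finset ι) (a c : ι → A) (w : ι → W)
    (hpair : ∀ i ∈ s, ∀ j ∈ s, ∀ x y : A, x * a i = y * a j → x • w i - y • w j ∈ Q)
    (hsum : ∑ i ∈ s, c i * a i = 0) : ∑ i ∈ s, c i • w i ∈ Q := by
  classical
  induction s using Finset.induction_on generalizing c with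
  | empty => simp
  | insert r s hr ih =>
    rw [Finset.sum_insert hr] at hsum ⊢
    obtain ⟨y, z, hy, hyz⟩ := exists_sum_eq_of_dvd_of_mem_span s a (fun i => -c i)
      (x := c r * a r) (b := a r)
      (by simp only [neg_mul, Finset.sum_neg_distrib]; exact eq_neg_of_add_eq_zero_left hsum)
      (dvd_mul_left _ _)
    have h1 : ∑ i ∈ s, (y i + c i) • w i ∈ Q := by
      refine ih (fun i => y i + c i) (fun i hi j hj => hpair i (Finset.mem_insert_of_mem hi) j
        (Finset.mem_insert_of_mem hj)) ?_
      simp only [add_mul, Finset.sum_add_distrib]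
      rw [← hy, hsum]
    have h2 : ∑ i ∈ s, (z i • w r - y i • w i) ∈ Q := Submodule.sum_mem _ fun i hi =>
      hpair r (Finset.mem_insert_self r s) i (Finset.mem_insert_of_mem hi) _ _ (hyz i hi).symm
    have h3 : (c r - ∑ i ∈ s, z i) • w r - (0 : A) • w r ∈ Q := by
      refine hpair r (Finset.mem_insert_self r s) r (Finset.mem_insert_self r s) _ _ ?_
      rw [sub_mul, Finset.sum_mul, ← Finset.sum_congr rfl hyz, ← hy, sub_self, zero_mul]
    convert Q.add_mem (Q.add_mem h1 h2) h3 using 1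
    simp only [add_smul, Finset.sum_add_distrib, Finset.sum_sub_distrib, sub_smul,
      Finset.sum_smul, zero_smul]
    abel

theorem prod_pow_dvd_of_mul_eq {R : Type*} [CommRing R] [IsDomain R] [IsPrincipalIdealRing R]
    {k : ℕ} {p : Fin k → R} (hirr : ∀ i, Irreducible (p i))
    (hassoc : ∀ i j, i ≠ j → ¬ Associated (p i) (p j)) (a b : Fin k → ℕ) {x y : R}
    (h : x * ∏ t, p t ^ a t = y * ∏ t, p t ^ b t) :
    ∃ s, x = s * ∏ t, p t ^ (max (a t) (b t) - a t) ∧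
      y = s * ∏ t, p t ^ (max (a t) (b t) - b t) := by
  have hsplit : ∀ a b : Fin k → ℕ, ∏ t, p t ^ a t =
      (∏ t, p t ^ min (a t) (b t)) * ∏ t, p t ^ (max (a t) (b t) - b t) := fun a b => by
    rw [← Finset.prod_mul_distrib]
    exact Finset.prod_congr rfl fun t _ => by rw [← pow_add]; congr 1; omega
  have hne : ∀ a : Fin k → ℕ, ∏ t, p t ^ a t ≠ 0 := fun a =>
    Finset.prod_ne_zero_iff.2 fun t _ => pow_ne_zero _ (hirr t).ne_zero
  have hcop : IsCoprime (∏ t, p t ^ (max (a t) (b t) - a t))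
      (∏ t, p t ^ (max (a t) (b t) - b t)) := by
    refine IsCoprime.prod_left fun i _ => IsCoprime.prod_right fun j _ => ?_
    rcases eq_or_ne i j with rfl | hij
    · rcases le_total (a i) (b i) with h | h
      · rw [max_eq_right h, tsub_self, pow_zero]; exact isCoprime_one_right
      · rw [max_eq_left h, tsub_self, pow_zero]; exact isCoprime_one_left
    · refine IsCoprime.pow ((hirr i).coprime_iff_not_dvd.2 fun hd => hassoc i j hij ?_)
      exact (hirr i).associated_of_dvd (hirr j) hd
  have h' : x * ∏ t, p t ^ (max (a t) (b t) - b t) = y * ∏ t, p t ^ (max (a t) (b t) - a t) := by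
    refine mul_left_cancel₀ (hne fun t => min (a t) (b t)) ?_
    have hb := hsplit b a
    simp only [min_comm (b _), max_comm (b _)] at hb
    rw [hsplit a b, hb] at h
    linear_combination h
  obtain ⟨s, rfl⟩ := hcop.dvd_of_dvd_mul_right (Dvd.intro_left y h'.symm)
  refine ⟨s, mul_comm _ _, ?_⟩
  refine mul_right_cancel₀ (hne fun t => max (a t) (b t) - a t) ?_
  linear_combination -h'

theorem exists_syzygy_quotient {R : Type*} [CommRing R] [IsDomain R] [IsPrincipalIdealRing R]
    {N : R} {k : ℕ} {p : Fin k → R} (hirr : ∀ i, Irreducible (p i))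
    (hassoc : ∀ i j, i ≠ j → ¬ Associated (p i) (p j)) {nn : Fin k → ℕ}
    (hfact : N = ∏ i, p i ^ nn i) {a : Fin k → ℕ} (b : Fin k → ℕ) (ha : ∀ t, a t ≤ nn t)
    {x y : R ⧸ Ideal.span {N}}
    (h : x * Ideal.Quotient.mk (Ideal.span {N}) (∏ t, p t ^ a t) =
      y * Ideal.Quotient.mk (Ideal.span {N}) (∏ t, p t ^ b t)) :
    ∃ s r : R ⧸ Ideal.span {N},
      x = s * Ideal.Quotient.mk _ (∏ t, p t ^ (max (a t) (b t) - a t)) +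
        r * Ideal.Quotient.mk _ (∏ t, p t ^ (nn t - a t)) ∧
      y = s * Ideal.Quotient.mk _ (∏ t, p t ^ (max (a t) (b t) - b t)) := by
  obtain ⟨x, rfl⟩ := Ideal.Quotient.mk_surjective x
  obtain ⟨y, rfl⟩ := Ideal.Quotient.mk_surjective y
  rw [← map_mul, ← map_mul, Ideal.Quotient.eq, Ideal.mem_span_singleton] at h
  obtain ⟨c, hc⟩ := h
  have hN : N = (∏ t, p t ^ (nn t - a t)) * ∏ t, p t ^ a t := by
    rw [hfact, ← Finset.prod_mul_distrib]
    exact Finset.prod_congr rfl fun t _ => by rw [← pow_add, Nat.sub_add_cancel (ha t)]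
  obtain ⟨s, hx, hy⟩ := prod_pow_dvd_of_mul_eq hirr hassoc a b
    (x := x - c * ∏ t, p t ^ (nn t - a t)) (y := y) (by linear_combination hc + c * hN)
  refine ⟨Ideal.Quotient.mk _ s, Ideal.Quotient.mk _ c, ?_, ?_⟩
  · rw [← map_mul, ← map_mul, ← map_add, ← hx, sub_add_cancel]
  · rw [← map_mul, ← hy]

end Syzygies

end PaperGB

/-- Buchberger's criterion over a quotient of a PID. -/
theorem buchberger_criterion_quotient_PID
    {n : ℕ} {R : Type*} [CommRing R] [IsDomain R] [IsPrincipalIdealRing R]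
    (N : R) (hN0 : N ≠ 0) (hNu : ¬ IsUnit N)
    {k : ℕ} (p : Fin k → R) (hirr : ∀ i, Irreducible (p i))
    (hassoc : ∀ i j, i ≠ j → ¬ Associated (p i) (p j))
    (nn : Fin k → ℕ) (hfact : N = ∏ i, p i ^ nn i)
    (m : MonomialOrder (Fin n))
    {M : ℕ} (f : Fin M → MvPolynomial (Fin n) (R ⧸ Ideal.span {N}))
    (hf : ∀ i, f i ≠ 0)
    (v : Fin M → (R ⧸ Ideal.span {N})ˣ) (α : Fin M → Fin k → ℕ)
    (hα : ∀ i t, α i t ≤ nn t)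
    (hlc : ∀ i, mLC m (f i) =
      ↑(v i) * Ideal.Quotient.mk (Ideal.span {N}) (∏ t, p t ^ α i t)) :
    IsGroebnerBasis m (Ideal.span (Set.range f)) f ↔
      ((∀ i, ReducesToZero m f
        (MvPolynomial.C (Ideal.Quotient.mk (Ideal.span {N})
          (∏ t, p t ^ (nn t - α i t))) * f i)) ∧
       ∀ i j : Fin M, i < j → ReducesToZero m f (sPolyQuot N m p f v α i j)) := by
  have hann : ∀ i, Ideal.Quotient.mk (Ideal.span {N}) (∏ t, p t ^ (nn t - α i t)) *
      Ideal.Quotient.mk (Ideal.span {N}) (∏ t, p t ^ α i t) = 0 := fun i => by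
    rw [← map_mul, ← Finset.prod_mul_distrib, Ideal.Quotient.eq_zero_iff_mem,
      Ideal.mem_span_singleton, hfact]
    refine dvd_of_eq (Finset.prod_congr rfl fun t _ => ?_)
    rw [← pow_add, Nat.sub_add_cancel (hα i t)]
  have hS : ∀ i j, sPolyQuot N m p f v α i j ∈ Ideal.span (Set.range f) := fun i j =>
    sub_mem (Ideal.mul_mem_left _ _ (Ideal.subset_span ⟨i, rfl⟩))
      (Ideal.mul_mem_left _ _ (Ideal.subset_span ⟨j, rfl⟩))
  constructor
  · rintro ⟨-, -, hG⟩
    refine ⟨fun i => reducesToZero_iff.2 (mem_boundedSpan_of_leadingTerms hG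
      (Ideal.mul_mem_left _ _ (Ideal.subset_span ⟨i, rfl⟩))), fun i j _ =>
      reducesToZero_iff.2 (mem_boundedSpan_of_leadingTerms hG (hS i j))⟩
  · rintro ⟨hA, hB⟩
    have hlc' : ∀ i, m.leadingCoeff (f i) =
      ↑(v i) * Ideal.Quotient.mk (Ideal.span {N}) (∏ t, p t ^ α i t) := hlc
    have : IsPrincipalIdealRing (R ⧸ Ideal.span {N}) :=
      IsPrincipalIdealRing.of_surjective (Ideal.Quotient.mk (Ideal.span {N}))
        Ideal.Quotient.mk_surjective
    have hAmem : ∀ i, C (Ideal.Quotient.mk (Ideal.span {N}) (∏ t, p t ^ (nn t - α i t))) * f i ∈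
        boundedSpan m f (Set.Iio (m.toSyn (m.degree (f i)))) := fun i => by
      refine mem_boundedSpan_Iio ?_ ?_ (hA i)
      · rw [C_mul']
        exact m.degree_smul_le
      · rw [coeff_C_mul]
        change _ * m.leadingCoeff (f i) = 0
        rw [hlc', mul_left_comm, hann, mul_zero]
    have hSmem : ∀ i j, sPolyQuot N m p f v α i j ∈
        boundedSpan m f (Set.Iio (m.toSyn (m.degree (f i) ⊔ m.degree (f j)))) := by
      have hlt : ∀ i j, i < j → sPolyQuot N m p f v α i j ∈
          boundedSpan m f (Set.Iio (m.toSyn (m.degree (f i) ⊔ m.degree (f j)))) := by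
        intro i j hij
        refine mem_boundedSpan_Iio ?_ ?_ (hB i j hij)
        · exact m.degree_sub_le.trans (sup_le (degree_monomial_mul_le le_sup_left _)
            (degree_monomial_mul_le le_sup_right _))
        · rw [sPolyQuot, coeff_sub]
          refine (congrArg₂ (· - ·) (coeff_monomial_mul_eq le_sup_left _)
            (coeff_monomial_mul_eq le_sup_right _)).trans ?_
          have hl : (∏ t, p t ^ (max (α i t) (α j t) - α i t)) * ∏ t, p t ^ α i t =
              (∏ t, p t ^ (max (α i t) (α j t) - α j t)) * ∏ t, p t ^ α j t := by
            rw [← Finset.prod_mul_distrib, ← Finset.prod_mul_distrib]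
            refine Finset.prod_congr rfl fun t _ => ?_
            rw [← pow_add, ← pow_add]
            congr 1
            omega
          have hl' := congrArg (Ideal.Quotient.mk (Ideal.span {N})) hl
          rw [map_mul, map_mul] at hl'
          simp only [hlc']
          rw [mul_mul_mul_comm, mul_mul_mul_comm (↑(v j)⁻¹ : R ⧸ Ideal.span {N}),
            Units.inv_mul, Units.inv_mul, one_mul, one_mul, hl', sub_self]
      intro i j
      rcases lt_trichotomy i j with h | rfl | h
      · exact hlt i j h
      · simp only [sPolyQuot, sub_self]
        exact Submodule.zero_mem _
      · have := Submodule.neg_mem _ (hlt j i h)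
        rw [sup_comm]
        convert this using 1
        simp only [sPolyQuot, neg_sub, max_comm (α i _), sup_comm (mDeg m (f i))]
    refine ⟨hf, fun i => Ideal.subset_span ⟨i, rfl⟩, le_antisymm (Ideal.span_le.2 ?_)
      (Ideal.span_le.2 ?_)⟩
    · rintro _ ⟨i, rfl⟩
      exact Ideal.subset_span ⟨f i, ⟨Ideal.subset_span ⟨i, rfl⟩, hf i⟩, rfl⟩
    rintro _ ⟨g, ⟨hg, hg0⟩, rfl⟩
    refine mLT_mem_span_of_syzygies (fun e c hc hsum => ?_) hg hg0
    classical
    have hfilter : ∀ {B : Type _} [AddCommMonoid B] (F : Fin M → B),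
        (∀ i, c i = 0 → F i = 0) →
        ∑ i ∈ Finset.univ.filter (fun i => m.degree (f i) ≤ e), F i = ∑ i, F i := fun F hF =>
      Finset.sum_subset (Finset.filter_subset _ _) fun i _ hi =>
        hF i (hc i (by simpa using hi))
    have hmon : ∀ i (x : R ⧸ Ideal.span {N}), x • (monomial (e - m.degree (f i)) 1 * f i) =
        monomial (e - m.degree (f i)) x * f i := fun i x => by
      rw [← smul_mul_assoc, smul_monomial, smul_eq_mul, mul_one]
    have key := sum_smul_mem_of_pairwise (boundedSpan m f (Set.Iio (m.toSyn e)))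
      (Finset.univ.filter fun i => m.degree (f i) ≤ e) (fun i => m.leadingCoeff (f i)) c
      (fun i => monomial (e - m.degree (f i)) 1 * f i) ?_ ?_
    · simp only [hmon] at key
      rwa [hfilter _ fun i hi => by simp [hi]] at key
    · intro i hi j hj x y hxy
      have hi : m.degree (f i) ≤ e := by simpa using hi
      have hj : m.degree (f j) ≤ e := by simpa using hj
      simp only [hlc', ← mul_assoc] at hxy
      obtain ⟨s, r, hx, hy⟩ := exists_syzygy_quotient hirr hassoc hfact (α j) (hα i) hxy
      rw [← Units.eq_mul_inv_iff_mul_eq] at hx hy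
      have h1 := monomial_mul_mem_boundedSpan_Iio (d := e - (m.degree (f i) ⊔ m.degree (f j)))
        (hSmem i j) s
      have h2 := monomial_mul_mem_boundedSpan_Iio (d := e - m.degree (f i))
        (hAmem i) (r * ↑(v i)⁻¹)
      rw [tsub_add_cancel_of_le (sup_le hi hj)] at h1
      rw [tsub_add_cancel_of_le hi] at h2
      convert Submodule.add_mem _ h1 h2 using 1
      have hmDeg : ∀ g : MvPolynomial (Fin n) (R ⧸ Ideal.span {N}), mDeg m g = m.degree g :=
        fun _ => rfl
      rw [hmon, hmon, sPolyQuot, mul_sub, ← mul_assoc, ← mul_assoc, ← mul_assoc, monomial_mul,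
        monomial_mul, mul_comm (monomial _ _) (C _), C_mul_monomial]
      simp only [hmDeg]
      rw [tsub_add_tsub_cancel (sup_le hi hj) le_sup_left,
        tsub_add_tsub_cancel (sup_le hi hj) le_sup_right, hx, hy, sub_add_eq_add_sub, ← add_mul,
        ← map_add]
      congr 3 <;> ring_nf
    · rw [hfilter _ fun i hi => by simp [hi]]
      exact hsum
end
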